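/- arXiv:1404.2949 — 6 statements merged into one kernel-verified Lean document; each statement's English description precedes it below -/
import Mathlib

section
/- Let f : [0,1]^d → ℝ be smooth on simplices and let x ∈ (0,1)^d be an interior point with coincidence partition d(x) = {P_1,…,P_k}. Choose J = {j_1,…,j_k} with j_i ∈ P_i, let H := {1,…,d} \ J, and let V_H ⊆ {0,1}^d be the set of vectors supported on H. Then for every v ∈ {0,1}^d and every v' ∈ V_H there exist ε > 0, an open neighbourhood U ⊆ (0,1)^d of x, and a C^∞ function F on U such that ∑_{v_H ∈ V_H} (−1)^{⟨v_H,v'⟩} Δ_h^{v+v_H} f(x') = ∑_{v_H ∈ V_H} (−1)^{⟨v_H,v'⟩} Δ_h^{v+v_H} F(x') holds for all x' ∈ U with d(x') = d(x) and all 0 < h < ε (here v + v_H is addition in (ℤ/2)^d). -/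
open MeasureTheory Filter Set

namespace Paper

variable {d : ℕ}

/-- The closed unit cube `[0,1]^d`. -/
def cubeIcc (d : ℕ) : Set (Fin d → ℝ) := Set.Icc 0 1

/-- The half-open cube `[0,1)^d`. -/
def cubeIco (d : ℕ) : Set (Fin d → ℝ) := Set.univ.pi fun _ => Set.Ico (0:ℝ) 1

/-- The open cube `(0,1)^d`. -/
def cubeIoo (d : ℕ) : Set (Fin d → ℝ) := Set.univ.pi fun _ => Set.Ioo (0:ℝ) 1

/-- The sign `(−1)^{⟨v,w⟩}` for `v, w ∈ {0,1}^d`. -/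
def sgn (v w : Fin d → Bool) : ℝ :=
  (-1) ^ (Finset.univ.filter fun i => v i = true ∧ w i = true).card

/-- `|v|`, the number of nonzero entries of `v ∈ {0,1}^d`. -/
def wt (v : Fin d → Bool) : ℕ := (Finset.univ.filter fun i => v i = true).card

/-- The vector `h^w = h·((−1)^{w_1},…,(−1)^{w_d})`. -/
def shiftVec (h : ℝ) (w : Fin d → Bool) : Fin d → ℝ := fun i => if w i then -h else h

/-- The discrete Fourier difference `Δ_h^v f (x) = 2^{-d} ∑_w (−1)^{⟨v,w⟩} f(x + h^w)`. -/
noncomputable def dfourier (f : (Fin d → ℝ) → ℝ) (v : Fin d → Bool) (h : ℝ)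
    (x : Fin d → ℝ) : ℝ :=
  (1 / 2 ^ d) * ∑ w : Fin d → Bool, sgn v w * f (x + shiftVec h w)

/-- The partial derivative in direction `i`. -/
noncomputable def pderivI (i : Fin d) (f : (Fin d → ℝ) → ℝ) : (Fin d → ℝ) → ℝ :=
  fun x => fderiv ℝ f x (Pi.single i 1)

/-- The mixed partial derivative `D^v f = (∂/∂x_1)^{v_1} ⋯ (∂/∂x_d)^{v_d} f`. -/
noncomputable def Dmixed (v : Fin d → Bool) (f : (Fin d → ℝ) → ℝ) : (Fin d → ℝ) → ℝ :=
  (List.finRange d).foldr (fun i g => cond (v i) (pderivI i g) g) f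

/-- The Kuhn simplex `S_σ = {x ∈ [0,1]^d : x_{σ(1)} ≤ … ≤ x_{σ(d)}}`. -/
def KuhnSimplex (σ : Equiv.Perm (Fin d)) : Set (Fin d → ℝ) :=
  {x | x ∈ cubeIcc d ∧ ∀ i j : Fin d, i ≤ j → x (σ i) ≤ x (σ j)}

/-- A continuous function on the cube is smooth on simplices if its restriction to each
Kuhn simplex extends to a `C^∞` function on an open neighbourhood of the simplex. -/
def SmoothOnSimplices (f : (Fin d → ℝ) → ℝ) : Prop :=
  ContinuousOn f (cubeIcc d) ∧
  ∀ σ : Equiv.Perm (Fin d), ∃ (U : Set (Fin d → ℝ)) (g : (Fin d → ℝ) → ℝ),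
    IsOpen U ∧ KuhnSimplex σ ⊆ U ∧ ContDiffOn ℝ (⊤ : ℕ∞) g U ∧ Set.EqOn f g (KuhnSimplex σ)

/-- The centre `x̃^{(n)}` of the lattice cell of side `1/n` containing `x`. -/
noncomputable def latticeCenter (n : ℕ) (x : Fin d → ℝ) : Fin d → ℝ :=
  fun i => (⌊(n : ℝ) * x i⌋ : ℝ) / n + 1 / (2 * n)

/-- The `n`-th lattice approximation `Δ̃_n^v f (x) = Δ_{1/(2n)}^v f (x̃^{(n)})`. -/
noncomputable def latticeDelta (n : ℕ) (f : (Fin d → ℝ) → ℝ) (v : Fin d → Bool)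
    (x : Fin d → ℝ) : ℝ :=
  dfourier f v (1 / (2 * n)) (latticeCenter n x)

/-- `f` has generalised differential `L` at `x` to `v` in degree `α`. -/
def HasGenDeriv (f : (Fin d → ℝ) → ℝ) (v : Fin d → Bool) (α : ℕ)
    (x : Fin d → ℝ) (L : ℝ) : Prop :=
  Tendsto (fun h : ℝ => (1 / h ^ α) * dfourier f v h x) (nhdsWithin 0 (Set.Ioi 0)) (nhds L)

/-- The generalised differential `D_α^v f(x)` (the value of the limit when it exists). -/
noncomputable def genDeriv (f : (Fin d → ℝ) → ℝ) (v : Fin d → Bool) (α : ℕ)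
    (x : Fin d → ℝ) : ℝ :=
  limUnder (nhdsWithin 0 (Set.Ioi 0)) fun h : ℝ => (1 / h ^ α) * dfourier f v h x

/-- `x` has coincidence partition given by the fibres of the surjection `p`,
i.e. `d(x) = 𝒫` where `𝒫` is the partition of `{1,…,d}` into the fibres of `p`. -/
def CoincWith (x : Fin d → ℝ) {k : ℕ} (p : Fin d → Fin k) : Prop :=
  ∀ i j, x i = x j ↔ p i = p j

/-- The generalised diagonal `𝒟_𝒫 = {x ∈ (0,1)^d : d(x) = 𝒫}`. -/
def diagP {k : ℕ} (p : Fin d → Fin k) : Set (Fin d → ℝ) :=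
  {x | x ∈ cubeIoo d ∧ CoincWith x p}

/-- `α(𝒫,v)`: the number of blocks of `𝒫` containing an index `a` with `v_a = 1`. -/
def alphaP {k : ℕ} (p : Fin d → Fin k) (v : Fin d → Bool) : ℕ :=
  ((Finset.univ.filter fun i => v i = true).image p).card

lemma sgn_eq_prod {d : ℕ} (v w : Fin d → Bool) :
    sgn v w = ∏ i, (if v i = true ∧ w i = true then (-1 : ℝ) else 1) := by
  rw [sgn, Finset.prod_ite]; simp

lemma sgn_flip {d : ℕ} (a z : Fin d → Bool) (i : Fin d) :
    sgn (Function.update a i (!a i)) z = (if z i = true then (-1 : ℝ) else 1) * sgn a z := by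
  rw [sgn_eq_prod, sgn_eq_prod, ← Finset.mul_prod_erase _ _ (Finset.mem_univ i),
    ← Finset.mul_prod_erase _ (fun k => if a k = true ∧ z k = true then (-1 : ℝ) else 1)
      (Finset.mem_univ i), ← mul_assoc]
  congr 1
  · cases h1 : a i <;> cases h2 : z i <;> simp [h1, h2]
  · refine Finset.prod_congr rfl fun k hk => ?_
    rw [Function.update_of_ne (Finset.ne_of_mem_erase hk)]

lemma sgn_sum_zero {d : ℕ} (J : Finset (Fin d)) (v v' u : Fin d → Bool) (i : Fin d)
    (hi : i ∉ J) (hne : u i ≠ v' i) :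
    ∑ w ∈ Finset.univ.filter (fun w : Fin d → Bool => ∀ j ∈ J, w j = false),
      sgn w v' * sgn (fun k => xor (v k) (w k)) u = 0 := by
  refine Finset.sum_involution (fun w _ => Function.update w i (!w i)) ?_ ?_ ?_ ?_
  · intro w _
    have h2 : (fun k => xor (v k) (Function.update w i (!w i) k))
        = Function.update (fun k => xor (v k) (w k)) i (!(xor (v i) (w i))) := by
      funext k
      by_cases hk : k = i
      · subst hk; simp
      · simp [hk]
    rw [h2, sgn_flip, sgn_flip (fun k => xor (v k) (w k)) u i]
    cases h3 : u i <;> cases h4 : v' i <;> simp_all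
  · intro w _ _ h
    have := congrFun h i
    simp at this
  · intro w hw
    simp only [Finset.mem_filter, Finset.mem_univ, true_and] at hw ⊢
    intro j hj
    rw [Function.update_of_ne (by rintro rfl; exact hi hj)]
    exact hw j hj
  · intro w _
    simp

lemma sum_dfourier {d : ℕ} (J : Finset (Fin d)) (v v' : Fin d → Bool)
    (f : (Fin d → ℝ) → ℝ) (h : ℝ) (x : Fin d → ℝ) :
    ∑ w ∈ Finset.univ.filter (fun w : Fin d → Bool => ∀ j ∈ J, w j = false),
      sgn w v' * dfourier f (fun i => xor (v i) (w i)) h x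
    = ∑ u : Fin d → Bool, (1 / 2 ^ d) *
      (∑ w ∈ Finset.univ.filter (fun w : Fin d → Bool => ∀ j ∈ J, w j = false),
      sgn w v' * sgn (fun k => xor (v k) (w k)) u) * f (x + shiftVec h u) := by
  simp only [dfourier, Finset.mul_sum, Finset.sum_mul]
  rw [Finset.sum_comm]
  refine Finset.sum_congr rfl fun u _ => Finset.sum_congr rfl fun w _ => ?_
  ring

theorem statement1 {d : ℕ} (f : (Fin d → ℝ) → ℝ) (hf : SmoothOnSimplices f)
    (x : Fin d → ℝ) (hx : x ∈ cubeIoo d)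
    (J : Finset (Fin d)) (hJ : ∀ i : Fin d, ∃! j, j ∈ J ∧ x j = x i)
    (v v' : Fin d → Bool) (hv' : ∀ j ∈ J, v' j = false) :
    ∃ ε > (0 : ℝ), ∃ U : Set (Fin d → ℝ), IsOpen U ∧ x ∈ U ∧ U ⊆ cubeIoo d ∧
      ∃ F : (Fin d → ℝ) → ℝ, ContDiffOn ℝ (⊤ : ℕ∞) F U ∧
        ∀ x' ∈ U, (∀ i j, x' i = x' j ↔ x i = x j) →
          ∀ h : ℝ, 0 < h → h < ε →
            ∑ w ∈ Finset.univ.filter (fun w : Fin d → Bool => ∀ j ∈ J, w j = false),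
                sgn w v' * dfourier f (fun i => xor (v i) (w i)) h x'
              = ∑ w ∈ Finset.univ.filter (fun w : Fin d → Bool => ∀ j ∈ J, w j = false),
                sgn w v' * dfourier F (fun i => xor (v i) (w i)) h x' := by
  classical
  let t : Fin d → ℕ := fun i => if i ∈ J then 1 else if v' i then 0 else 2
  let key : Fin d → ℝ ×ₗ ℕ := fun i => toLex (x i, t i)
  let σ := Tuple.sort key
  have hσ : ∀ i j : Fin d, i ≤ j →
      x (σ i) < x (σ j) ∨ x (σ i) = x (σ j) ∧ t (σ i) ≤ t (σ j) := by
    intro i j hij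
    have := Tuple.monotone_sort key hij
    simpa [key, σ, Prod.Lex.toLex_le_toLex] using this
  obtain ⟨V, g, hVo, hSV, hg, hfg⟩ := hf.2 σ
  have hx' : ∀ i, 0 < x i ∧ x i < 1 := fun i => by simpa using hx i (Set.mem_univ i)
  obtain ⟨δ, ⟨hδ1, hδ2, hδ3⟩, hδ⟩ : ∃ δ : ℝ, ((∀ i j, x i < x j → 4 * δ < x j - x i) ∧
      (∀ i, 2 * δ < x i) ∧ (∀ i, 2 * δ < 1 - x i)) ∧ 0 < δ := by
    have aux : ∀ (c r : ℝ), 0 < r → ∀ᶠ δ in nhdsWithin (0:ℝ) (Set.Ioi 0), c * δ < r := by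
      intro c r hr
      have : Tendsto (fun δ : ℝ => c * δ) (nhds 0) (nhds 0) := by
        simpa using (continuous_const_mul c).tendsto (0:ℝ)
      exact (this.mono_left nhdsWithin_le_nhds).eventually (gt_mem_nhds hr)
    have h1 : ∀ᶠ δ in nhdsWithin (0:ℝ) (Set.Ioi 0), ∀ i j, x i < x j → 4 * δ < x j - x i := by
      refine eventually_all.2 fun i => eventually_all.2 fun j => ?_
      by_cases h : x i < x j
      · filter_upwards [aux 4 _ (sub_pos.2 h)] with δ hd _ using hd
      · exact Eventually.of_forall fun δ h' => absurd h' h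
    have h2 := eventually_all.2 fun i => aux 2 (x i) (hx' i).1
    have h3 := eventually_all.2 fun i => aux 2 (1 - x i) (sub_pos.2 (hx' i).2)
    exact ((h1.and (h2.and h3)).and self_mem_nhdsWithin).exists
  have hxS : x ∈ KuhnSimplex σ := by
    refine ⟨⟨fun i => (hx' i).1.le, fun i => (hx' i).2.le⟩, fun i j hij => ?_⟩
    rcases hσ i j hij with h | h
    · exact h.le
    · exact h.1.le
  refine ⟨δ, hδ, V ∩ cubeIoo d ∩ Metric.ball x δ, ?_, ⟨⟨hSV hxS, hx⟩, Metric.mem_ball_self hδ⟩,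
    fun y hy => hy.1.2, g, hg.mono fun y hy => hy.1.1, ?_⟩
  · exact (hVo.inter (isOpen_set_pi Set.finite_univ fun _ _ => isOpen_Ioo)).inter
      Metric.isOpen_ball
  intro x' hxU hco h hh0 hhδ
  rw [sum_dfourier, sum_dfourier]
  refine Finset.sum_congr rfl fun u _ => ?_
  by_cases hu : ∀ i, i ∉ J → u i = v' i
  swap
  · push Not at hu
    obtain ⟨i, hi, hne⟩ := hu
    rw [sgn_sum_zero J v v' u i hi hne]; simp
  congr 1
  apply hfg
  have hd : ∀ i, x i - δ < x' i ∧ x' i < x i + δ := by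
    intro i
    have h1 := (dist_le_pi_dist x' x i).trans_lt (Metric.mem_ball.1 hxU.2)
    rw [Real.dist_eq, abs_lt] at h1
    constructor <;> linarith
  have hs : ∀ i, -h ≤ shiftVec h u i ∧ shiftVec h u i ≤ h := by
    intro i
    unfold shiftVec
    split_ifs <;> constructor <;> linarith
  refine ⟨⟨fun i => ?_, fun i => ?_⟩, fun i j hij => ?_⟩
  · have := hd i; have := hs i; have := hδ2 i
    simp only [Pi.zero_apply, Pi.add_apply]; linarith
  · have := hd i; have := hs i; have := hδ3 i
    simp only [Pi.one_apply, Pi.add_apply]; linarith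
  · simp only [Pi.add_apply]
    have hji := hσ i j hij
    generalize σ i = a at *
    generalize σ j = b at *
    rcases hji with hlt | ⟨heq, ht⟩
    · have := hd a; have := hs a; have := hd b; have := hs b; have := hδ1 a b hlt
      linarith
    · rw [(hco a b).2 heq]
      suffices shiftVec h u a ≤ shiftVec h u b by linarith
      have hJab : a ∈ J → b ∈ J → a = b := fun ha hb =>
        (hJ b).unique ⟨ha, heq⟩ ⟨hb, rfl⟩
      have hua := hu a
      have hub := hu b
      by_cases ha : a ∈ J <;> by_cases hb : b ∈ J
      · rw [hJab ha hb]
      · have hb' : v' b = false := by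
          by_contra hc
          rw [Bool.not_eq_false] at hc
          simp [t, ha, hb, hc] at ht
        have : shiftVec h u b = h := by simp [shiftVec, hub hb, hb']
        rw [this]; exact (hs a).2
      · have ha' : v' a = true := by
          by_contra hc
          simp [t, ha, hb, hc] at ht
        have : shiftVec h u a = -h := by simp [shiftVec, hua ha, ha']
        rw [this]; exact (hs b).1
      · cases h1 : v' a <;> cases h2 : v' b <;>
          simp [t, ha, hb, h1, h2, shiftVec, hua, hub] at ht ⊢
        linarith

end Paper
end

section
/- Let f : [0,1]^d → ℝ be smooth on simplices, let v ∈ {0,1}^d, let 𝒫 be a partition of {1,…,d} and set α := α(𝒫,v). Then for every point x in the generalised diagonal 𝒟_𝒫 the limit lim_{h→0⁺} h^{−α} Δ_h^v f(x) exists, and the resulting function x ↦ lim_{h→0⁺} h^{−α} Δ_h^v f(x) is continuous on 𝒟_𝒫. -/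
open MeasureTheory Filter Set

namespace Paper

variable {d : ℕ}

theorem taylor_dir {V : Type*} [NormedAddCommGroup V] [NormedSpace ℝ V] (g : V → ℝ) (U : Set V)
    (hU : IsOpen U) (hg : ContDiffOn ℝ (⊤ : ℕ∞) g U) (x : V) (hx : x ∈ U) (e : V) (n : ℕ) :
    Tendsto (fun h : ℝ => (h ^ n)⁻¹ * (g (x + h • e) - ∑ j ∈ Finset.range (n + 1),
      ((j.factorial : ℝ)⁻¹ * h ^ j) * iteratedFDeriv ℝ j g x (fun _ => e)))
      (nhdsWithin 0 (Set.Ioi 0)) (nhds 0) := by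
  set ℓ : ℝ →L[ℝ] V := ContinuousLinearMap.toSpanSingleton ℝ e with hℓ
  set G : V → ℝ := fun y => g (x + y) with hG
  set U' : Set V := (fun y => x + y) ⁻¹' U with hU'
  have hU'o : IsOpen U' := hU.preimage (by fun_prop)
  have hGc : ContDiffOn ℝ (⊤ : ℕ∞) G U' :=
    hg.comp (contDiff_const.add contDiff_id).contDiffOn (fun y hy => hy)
  have h0 : (0 : ℝ) ∈ ℓ ⁻¹' U' := by simp [hU', hx]
  have hpo : IsOpen (ℓ ⁻¹' U') := hU'o.preimage ℓ.continuous
  obtain ⟨ε, hε, hball⟩ := Metric.isOpen_iff.1 hpo 0 h0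
  have hφ : ContDiffOn ℝ n (G ∘ ℓ) (Metric.ball 0 ε) := by
    have : ContDiffOn ℝ (⊤ : ℕ∞) (G ∘ ℓ) (Metric.ball 0 ε) :=
      hGc.comp ℓ.contDiff.contDiffOn hball
    exact this.of_le (by exact_mod_cast le_top)
  have T := Real.taylor_tendsto (convex_ball (0:ℝ) ε) (Metric.mem_ball_self hε) hφ
  rw [nhdsWithin_eq_nhds.2 (Metric.ball_mem_nhds _ hε)] at T
  have T' := T.mono_left (nhdsWithin_le_nhds (s := Set.Ioi 0))
  refine T'.congr fun h => ?_
  have hd : ∀ j : ℕ, iteratedDerivWithin j (G ∘ ℓ) (Metric.ball 0 ε) 0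
      = iteratedFDeriv ℝ j g x (fun _ => e) := by
    intro j
    have h1 := ℓ.iteratedFDerivWithin_comp_right hGc hU'o.uniqueDiffOn hpo.uniqueDiffOn h0
      (i := j) (by exact_mod_cast le_top)
    rw [iteratedDerivWithin, iteratedFDerivWithin_of_isOpen j Metric.isOpen_ball
      (Metric.mem_ball_self hε), ← iteratedFDerivWithin_of_isOpen j hpo h0, h1,
      iteratedFDerivWithin_of_isOpen j hU'o h0]
    simp only [hG, hℓ, iteratedFDeriv_comp_add_left]
    simp
  rw [taylor_within_apply]
  simp only [hd, sub_zero, smul_eq_mul]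
  simp [div_eq_inv_mul, hG, hℓ]

theorem alt_sum_zero {ι : Type*} [DecidableEq ι] (T : Finset ι) (F : Finset ι → ℝ) (b : ι)
    (hb : b ∈ T) (hF : ∀ S, b ∉ S → F (insert b S) = F S) :
    ∑ S ∈ T.powerset, (-1 : ℝ) ^ (T.card + S.card) * F S = 0 := by
  rw [← Finset.insert_erase hb, Finset.sum_powerset_insert (Finset.notMem_erase b T),
    ← Finset.sum_add_distrib]
  refine Finset.sum_eq_zero fun S hS => ?_
  have : b ∉ S := fun h => Finset.notMem_erase b T (Finset.mem_powerset.1 hS h)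
  rw [hF S this, Finset.card_insert_of_notMem this]
  ring

/-- partial direction -/
noncomputable def dirS {V ι : Type*} [AddCommGroup V] [Fintype ι] [DecidableEq ι]
    (E : ι → V) (T S : Finset ι) : V := ∑ a, if a ∈ S ∨ a ∉ T then E a else 0

theorem alt_multi {V ι : Type*} [NormedAddCommGroup V] [NormedSpace ℝ V] [Fintype ι] [DecidableEq ι]
    (E : ι → V) (T : Finset ι) (j : ℕ) (hj : j < T.card)
    (M : ContinuousMultilinearMap ℝ (fun _ : Fin j => V) ℝ) :
    ∑ S ∈ T.powerset, (-1 : ℝ) ^ (T.card + S.card) * M (fun _ => dirS E T S) = 0 := by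
  simp only [dirS, ContinuousMultilinearMap.map_sum, Finset.mul_sum]
  rw [Finset.sum_comm]
  refine Finset.sum_eq_zero fun r _ => ?_
  obtain ⟨b, hb, hbr⟩ : ∃ b ∈ T, b ∉ Finset.univ.image r := by
    by_contra! hc
    have := (Finset.card_le_card (show T ⊆ Finset.univ.image r from hc)).trans
      Finset.card_image_le
    simp at this
    omega
  refine alt_sum_zero T (fun S => M fun i => if r i ∈ S ∨ r i ∉ T then E (r i) else 0) b hb ?_
  intro S _
  congr 1
  funext i
  have : r i ≠ b := fun h => hbr (by simp [← h])
  simp [this]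

theorem alt_tendsto {V ι : Type*} [NormedAddCommGroup V] [NormedSpace ℝ V] [Fintype ι]
    [DecidableEq ι] (g : V → ℝ) (U : Set V)
    (hU : IsOpen U) (hg : ContDiffOn ℝ (⊤ : ℕ∞) g U) (x : V) (hx : x ∈ U)
    (E : ι → V) (T : Finset ι) :
    Tendsto (fun h : ℝ => (h ^ T.card)⁻¹ *
      ∑ S ∈ T.powerset, (-1 : ℝ) ^ (T.card + S.card) * g (x + h • dirS E T S))
      (nhdsWithin 0 (Set.Ioi 0))
      (nhds (∑ S ∈ T.powerset, (-1 : ℝ) ^ (T.card + S.card) * ((T.card.factorial : ℝ)⁻¹ *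
        iteratedFDeriv ℝ T.card g x (fun _ => dirS E T S)))) := by
  have H := tendsto_finsetSum T.powerset fun S _ =>
    (taylor_dir g U hU hg x hx (dirS E T S) T.card).const_mul ((-1 : ℝ) ^ (T.card + S.card))
  simp only [mul_zero, Finset.sum_const_zero] at H
  have H2 := H.add_const (∑ S ∈ T.powerset, (-1 : ℝ) ^ (T.card + S.card) *
    ((T.card.factorial : ℝ)⁻¹ * iteratedFDeriv ℝ T.card g x (fun _ => dirS E T S)))
  rw [zero_add] at H2
  refine H2.congr' ?_
  filter_upwards [self_mem_nhdsWithin] with h hh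
  have hh0 : h ^ T.card ≠ 0 := pow_ne_zero _ (ne_of_gt hh)
  have key : ∑ S ∈ T.powerset, (-1 : ℝ) ^ (T.card + S.card) *
      (∑ j ∈ Finset.range (T.card + 1), ((j.factorial : ℝ)⁻¹ * h ^ j) *
        iteratedFDeriv ℝ j g x (fun _ => dirS E T S)) =
      h ^ T.card * ∑ S ∈ T.powerset, (-1 : ℝ) ^ (T.card + S.card) *
      ((T.card.factorial : ℝ)⁻¹ * iteratedFDeriv ℝ T.card g x (fun _ => dirS E T S)) := by
    simp only [Finset.sum_range_succ, mul_add, Finset.sum_add_distrib]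
    have : ∑ S ∈ T.powerset, (-1 : ℝ) ^ (T.card + S.card) *
      (∑ j ∈ Finset.range T.card, ((j.factorial : ℝ)⁻¹ * h ^ j) *
        iteratedFDeriv ℝ j g x (fun _ => dirS E T S)) = 0 := by
      simp only [Finset.mul_sum]
      rw [Finset.sum_comm]
      refine Finset.sum_eq_zero fun j hj => ?_
      have := alt_multi E T j (Finset.mem_range.1 hj) (iteratedFDeriv ℝ j g x)
      calc _ = ((j.factorial : ℝ)⁻¹ * h ^ j) * ∑ S ∈ T.powerset, (-1 : ℝ) ^ (T.card + S.card) *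
            iteratedFDeriv ℝ j g x (fun _ => dirS E T S) := by
            rw [Finset.mul_sum]; exact Finset.sum_congr rfl fun _ _ => by ring
        _ = 0 := by rw [this, mul_zero]
    rw [this, zero_add, Finset.mul_sum]
    exact Finset.sum_congr rfl fun _ _ => by ring
  have e1 : ∀ S : Finset ι, (-1 : ℝ) ^ (T.card + S.card) * ((h ^ T.card)⁻¹ *
      (g (x + h • dirS E T S) - ∑ j ∈ Finset.range (T.card + 1),
      ((j.factorial : ℝ)⁻¹ * h ^ j) * iteratedFDeriv ℝ j g x (fun _ => dirS E T S)))
      = (h ^ T.card)⁻¹ * ((-1 : ℝ) ^ (T.card + S.card) * g (x + h • dirS E T S)) -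
        (h ^ T.card)⁻¹ * ((-1 : ℝ) ^ (T.card + S.card) * ∑ j ∈ Finset.range (T.card + 1),
      ((j.factorial : ℝ)⁻¹ * h ^ j) * iteratedFDeriv ℝ j g x (fun _ => dirS E T S)) := by
    intro S; ring
  simp only [e1, Finset.sum_sub_distrib]
  simp only [← Finset.mul_sum]
  rw [key, inv_mul_cancel_left₀ hh0, sub_add_cancel]

/-- block directions -/
noncomputable def blockE {k : ℕ} (p : Fin d → Fin k) (w : Fin d → Bool) (A : Fin k) : Fin d → ℝ :=
  fun i => if p i = A then (if w i then -1 else 1) else 0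

theorem dirS_blockE {k : ℕ} (p : Fin d → Fin k) (w : Fin d → Bool) (T S : Finset (Fin k))
    (i : Fin d) : dirS (blockE p w) T S i =
      if p i ∈ S ∨ p i ∉ T then (if w i then -1 else 1) else 0 := by
  rw [dirS, Finset.sum_apply, Finset.sum_eq_single (p i)]
  · split_ifs <;> simp_all [blockE]
  · intro b _ hb
    split_ifs
    · simp [blockE, hb.symm]
    · rfl
  · simp

theorem smul_dirS_self {k : ℕ} (p : Fin d → Fin k) (w : Fin d → Bool) (T : Finset (Fin k))
    (h : ℝ) : h • dirS (blockE p w) T T = shiftVec h w := by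
  funext i
  have : p i ∈ T ∨ p i ∉ T := em _
  rw [Pi.smul_apply, dirS_blockE, if_pos this, shiftVec]
  split_ifs <;> simp

theorem sgn_flip_s3 (v w : Fin d → Bool) (a : Fin d) (ha : v a = true) :
    sgn v (Function.update w a (!w a)) = - sgn v w := by
  have hp : ∀ u : Fin d → Bool, sgn v u = ∏ i, if v i = true ∧ u i = true then (-1 : ℝ) else 1 := by
    intro u
    rw [sgn, Finset.prod_ite]
    simp
  rw [hp, hp, ← Finset.mul_prod_erase _ _ (Finset.mem_univ a),
    ← Finset.mul_prod_erase (a := a) _ (fun i => if v i = true ∧ w i = true then (-1 : ℝ) else 1)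
      (Finset.mem_univ a)]
  have : ∏ i ∈ Finset.univ.erase a, (if v i = true ∧ Function.update w a (!w a) i = true
      then (-1 : ℝ) else 1) = ∏ i ∈ Finset.univ.erase a, if v i = true ∧ w i = true
      then (-1 : ℝ) else 1 := by
    refine Finset.prod_congr rfl fun i hi => ?_
    rw [Function.update_of_ne (Finset.ne_of_mem_erase hi)]
  rw [this]
  cases hw : w a <;> simp [ha]

theorem sum_vanish {k : ℕ} (f : (Fin d → ℝ) → ℝ) (v : Fin d → Bool) (p : Fin d → Fin k)
    (T S : Finset (Fin k)) (hT : T = (Finset.univ.filter fun i => v i = true).image p)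
    (hS : S ⊆ T) (hne : S ≠ T) (x : Fin d → ℝ) (h : ℝ) :
    ∑ w : Fin d → Bool, sgn v w * f (x + h • dirS (blockE p w) T S) = 0 := by
  obtain ⟨b, hbT, hbS⟩ := Finset.exists_of_ssubset (hS.ssubset_of_ne hne)
  have hbT' := hbT
  rw [hT] at hbT'
  obtain ⟨a, ha, rfl⟩ := Finset.mem_image.1 hbT'
  have ha' : v a = true := by simpa using ha
  have hinv : Function.Involutive (fun w : Fin d → Bool => Function.update w a (!w a)) := by
    intro w
    simp
  have hd : ∀ w : Fin d → Bool, dirS (blockE p (Function.update w a (!w a))) T S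
      = dirS (blockE p w) T S := by
    intro w
    funext i
    rw [dirS_blockE, dirS_blockE]
    by_cases hi : i = a
    · subst hi
      simp [hbT, hbS]
    · simp [hi]
  have h1 := Equiv.sum_comp hinv.toPerm
    (fun w : Fin d → Bool => sgn v w * f (x + h • dirS (blockE p w) T S))
  simp only [Function.Involutive.coe_toPerm, hd, sgn_flip_s3 v _ a ha', neg_mul,
    Finset.sum_neg_distrib] at h1
  linarith

theorem dfourier_expand {k : ℕ} (f : (Fin d → ℝ) → ℝ) (v : Fin d → Bool) (p : Fin d → Fin k)
    (T : Finset (Fin k)) (hT : T = (Finset.univ.filter fun i => v i = true).image p)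
    (x : Fin d → ℝ) (h : ℝ) :
    dfourier f v h x = (1 / 2 ^ d) * ∑ w : Fin d → Bool, sgn v w *
      ∑ S ∈ T.powerset, (-1 : ℝ) ^ (T.card + S.card) * f (x + h • dirS (blockE p w) T S) := by
  rw [dfourier]
  congr 1
  simp only [Finset.mul_sum]
  rw [Finset.sum_comm, Finset.sum_eq_single T]
  · refine Finset.sum_congr rfl fun w _ => ?_
    rw [smul_dirS_self, ← two_mul, pow_mul]
    simp
  · intro S hS hne
    have := sum_vanish f v p T S hT (Finset.mem_powerset.1 hS) hne x h
    calc _ = (-1 : ℝ) ^ (T.card + S.card) *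
          ∑ w : Fin d → Bool, sgn v w * f (x + h • dirS (blockE p w) T S) := by
          rw [Finset.mul_sum]; exact Finset.sum_congr rfl fun _ _ => by ring
      _ = 0 := by rw [this, mul_zero]
  · intro hn
    simp at hn

theorem exists_simplex {k : ℕ} (p : Fin d → Fin k) (w : Fin d → Bool) (T : Finset (Fin k))
    (x₀ : Fin d → ℝ) (hx₀ : x₀ ∈ diagP p) :
    ∃ σ : Equiv.Perm (Fin d), ∀ᶠ x in nhdsWithin x₀ (diagP p), ∀ S : Finset (Fin k),
      ∀ᶠ h : ℝ in nhdsWithin 0 (Set.Ici 0),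
        x + h • dirS (blockE p w) T S ∈ KuhnSimplex σ := by
  let key : Fin d → Lex (ℝ × Bool) := fun i => toLex (x₀ i, !w i)
  refine ⟨Tuple.sort key, ?_⟩
  have hmono := Tuple.monotone_sort key
  have hlt : ∀ᶠ x in nhds x₀, ∀ a b : Fin d, x₀ a < x₀ b → x a < x b := by
    refine eventually_all.2 fun a => eventually_all.2 fun b => ?_
    by_cases hab : x₀ a < x₀ b
    · have := (continuous_apply (A := fun _ : Fin d => ℝ) a).continuousAt.eventually_lt
        (continuous_apply (A := fun _ : Fin d => ℝ) b).continuousAt hab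
      exact this.mono fun _ h _ => h
    · exact Eventually.of_forall fun _ h => absurd h hab
  filter_upwards [nhdsWithin_le_nhds hlt, self_mem_nhdsWithin] with x hx hxD S
  have hc : ∀ i, Continuous fun h : ℝ => (x + h • dirS (blockE p w) T S) i := by
    intro i
    simp only [Pi.add_apply, Pi.smul_apply]
    fun_prop
  have hlt' : ∀ᶠ h in nhds (0 : ℝ), ∀ a b : Fin d, x₀ a < x₀ b →
      (x + h • dirS (blockE p w) T S) a < (x + h • dirS (blockE p w) T S) b := by
    refine eventually_all.2 fun a => eventually_all.2 fun b => ?_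
    by_cases hab : x₀ a < x₀ b
    · have := (hc a).continuousAt.eventually_lt (hc b).continuousAt
        (by simpa using hx a b hab : _ < (x + (0:ℝ) • dirS (blockE p w) T S) b)
      exact this.mono fun _ h _ => h
    · exact Eventually.of_forall fun _ h => absurd h hab
  have hin : ∀ᶠ h in nhds (0 : ℝ), ∀ a : Fin d,
      (x + h • dirS (blockE p w) T S) a ∈ Set.Ioo (0:ℝ) 1 := by
    refine eventually_all.2 fun a => ?_
    refine (hc a).continuousAt.eventually_mem (isOpen_Ioo.mem_nhds ?_)
    simpa using hxD.1 a (Set.mem_univ a)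
  filter_upwards [nhdsWithin_le_nhds hlt', nhdsWithin_le_nhds hin, self_mem_nhdsWithin]
    with h h1 h2 h3
  refine ⟨⟨fun i => (h2 i).1.le, fun i => (h2 i).2.le⟩, fun i j hij => ?_⟩
  have claim : ∀ a b : Fin d, (x₀ a < x₀ b ∨ x₀ a = x₀ b ∧ (!w a) ≤ (!w b)) →
      (x + h • dirS (blockE p w) T S) a ≤ (x + h • dirS (blockE p w) T S) b := by
    rintro a b (hk | ⟨hk, hb⟩)
    · exact (h1 _ _ hk).le
    · have hpp := (hx₀.2 _ _).1 hk
      have hxx := (hxD.2 _ _).2 hpp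
      have h3' : (0:ℝ) ≤ h := h3
      simp only [Pi.add_apply, Pi.smul_apply, dirS_blockE, hpp, hxx, smul_eq_mul]
      revert hb
      generalize w a = bi
      generalize w b = bj
      intro hb
      cases bi <;> cases bj
      · simp
      · exact absurd hb (by decide)
      · split_ifs <;> simp_all <;> linarith
      · simp
  have hk := hmono hij
  simp only [Function.comp, key, Prod.Lex.toLex_le_toLex] at hk
  exact claim _ _ hk

theorem local_genDeriv {k : ℕ} (f : (Fin d → ℝ) → ℝ) (hf : SmoothOnSimplices f)
    (v : Fin d → Bool) (p : Fin d → Fin k) (x₀ : Fin d → ℝ) (hx₀ : x₀ ∈ diagP p) :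
    ∃ M : (Fin d → ℝ) → ℝ, ContinuousAt M x₀ ∧
      ∀ᶠ x in nhdsWithin x₀ (diagP p), HasGenDeriv f v (alphaP p v) x (M x) := by
  set T := (Finset.univ.filter fun i => v i = true).image p with hT
  have hα : alphaP p v = T.card := rfl
  choose σ hσ using fun w => exists_simplex p w T x₀ hx₀
  choose U g hU hKU hg hfg using hf.2
  have hxU : ∀ w, ∀ᶠ x in nhdsWithin x₀ (diagP p), x ∈ U (σ w) := by
    intro w
    filter_upwards [hσ w] with x hx
    have := (hx ∅).self_of_nhdsWithin (Set.mem_Ici.2 le_rfl)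
    apply hKU
    simpa using this
  have hx₀U : ∀ w, x₀ ∈ U (σ w) := fun w => (hxU w).self_of_nhdsWithin hx₀
  refine ⟨fun x => (1 / 2 ^ d) * ∑ w : Fin d → Bool, sgn v w * ∑ S ∈ T.powerset,
    (-1 : ℝ) ^ (T.card + S.card) * ((T.card.factorial : ℝ)⁻¹ *
        iteratedFDeriv ℝ T.card (g (σ w)) x (fun _ => dirS (blockE p w) T S)), ?_, ?_⟩
  · refine continuousAt_const.mul (tendsto_finsetSum _ fun w _ => continuousAt_const.mul
      (tendsto_finsetSum _ fun S _ => continuousAt_const.mul (continuousAt_const.mul ?_)))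
    have h1 : ContinuousAt (iteratedFDeriv ℝ T.card (g (σ w))) x₀ :=
      ((hg (σ w)).contDiffAt ((hU (σ w)).mem_nhds (hx₀U w))).continuousAt_iteratedFDeriv
        (by exact_mod_cast le_top)
    exact (ContinuousMultilinearMap.apply ℝ (fun _ : Fin T.card => Fin d → ℝ) ℝ
      (fun _ => dirS (blockE p w) T S)).continuous.continuousAt.comp h1
  · filter_upwards [eventually_all.2 hσ, eventually_all.2 hxU] with x hx hxu
    rw [HasGenDeriv, hα]
    have H := (tendsto_finsetSum Finset.univ fun w _ =>
      (alt_tendsto (g (σ w)) (U (σ w)) (hU _) (hg _) x (hxu w) (blockE p w) T).const_mul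
        (sgn v w)).const_mul (1 / 2 ^ d : ℝ)
    refine H.congr' ?_
    have hev : ∀ᶠ h : ℝ in nhdsWithin 0 (Set.Ioi 0), ∀ (w : Fin d → Bool) (S : Finset (Fin k)),
        x + h • dirS (blockE p w) T S ∈ KuhnSimplex (σ w) :=
      eventually_all.2 fun w => eventually_all.2 fun S =>
        nhdsWithin_mono _ Set.Ioi_subset_Ici_self (hx w S)
    filter_upwards [hev] with h hh
    rw [dfourier_expand f v p T hT]
    simp only [hfg _ (hh _ _), Finset.mul_sum]
    refine Finset.sum_congr rfl fun w _ => Finset.sum_congr rfl fun S _ => ?_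
    ring

/-- Let `f` be smooth on simplices, `v ∈ {0,1}^d`, `𝒫` a partition of
`{1,…,d}` (encoded by a surjection `p : Fin d → Fin k` onto its blocks) and
`α := α(𝒫,v)`.  Then for every `x` in the generalised diagonal `𝒟_𝒫` the limit
`lim_{h→0⁺} h^{−α} Δ_h^v f(x)` exists, and the resulting function is continuous
on `𝒟_𝒫`. -/
theorem statement3 {d k : ℕ} (f : (Fin d → ℝ) → ℝ) (hf : SmoothOnSimplices f)
    (v : Fin d → Bool) (p : Fin d → Fin k) (hp : Function.Surjective p) :
    ∃ L : (Fin d → ℝ) → ℝ, ContinuousOn L (diagP p) ∧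
      ∀ x ∈ diagP p, HasGenDeriv f v (alphaP p v) x (L x) := by
  have hloc : ∀ x ∈ diagP p, HasGenDeriv f v (alphaP p v) x (genDeriv f v (alphaP p v) x) := by
    intro x hx
    obtain ⟨M, -, hM⟩ := local_genDeriv f hf v p x hx
    have h1 : HasGenDeriv f v (alphaP p v) x (M x) := hM.self_of_nhdsWithin hx
    have h2 : genDeriv f v (alphaP p v) x = M x := Tendsto.limUnder_eq h1
    rw [h2]
    exact h1
  refine ⟨genDeriv f v (alphaP p v), fun x₀ hx₀ => ?_, hloc⟩
  obtain ⟨M, hMc, hM⟩ := local_genDeriv f hf v p x₀ hx₀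
  refine hMc.continuousWithinAt.congr_of_eventuallyEq_of_mem ?_ hx₀
  filter_upwards [hM] with x hx
  exact Tendsto.limUnder_eq hx

end Paper
end

section
/- Let f : [0,1]^2 → ℝ be continuous, let 𝒟 := {(x_1,x_2) ∈ (0,1)^2 : x_1 = x_2}, let S^+ := {x ∈ [0,1]^2 : x_1 ≤ x_2} and S^− := {x ∈ [0,1]^2 : x_2 ≤ x_1}, and suppose f restricted to S^+ (resp. S^−) extends to a C^∞ function f^+ (resp. f^−) on an open neighbourhood of S^+ (resp. S^−). Then for every x ∈ 𝒟 the limit lim_{h→0⁺} h^{−1} Δ_h^{(1,1)} f(x) exists and equals (1/2)·(∂/∂x_1)(f^+ − f^−)(x). -/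
open MeasureTheory Filter Set

namespace Paper

variable {d : ℕ}

/-- Let `f : [0,1]² → ℝ` be continuous, suppose the restrictions of `f` to
the triangles `S⁺ = {x₁ ≤ x₂}` and `S⁻ = {x₂ ≤ x₁}` extend to `C^∞` functions `f⁺`, `f⁻` on
open neighbourhoods of `S⁺`, `S⁻`.  Then for every `x` on the diagonal
`𝒟 = {x ∈ (0,1)² : x₁ = x₂}` the limit `lim_{h→0⁺} h^{−1} Δ_h^{(1,1)} f(x)` exists and
equals `(1/2)·(∂/∂x₁)(f⁺ − f⁻)(x)`. -/
theorem statement4 (f fp fm : (Fin 2 → ℝ) → ℝ)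
    (hf : ContinuousOn f (cubeIcc 2))
    (Up : Set (Fin 2 → ℝ)) (hUp : IsOpen Up)
    (hSp : {x | x ∈ cubeIcc 2 ∧ x 0 ≤ x 1} ⊆ Up)
    (hfp : ContDiffOn ℝ (⊤ : ℕ∞) fp Up)
    (hfpe : Set.EqOn f fp {x | x ∈ cubeIcc 2 ∧ x 0 ≤ x 1})
    (Um : Set (Fin 2 → ℝ)) (hUm : IsOpen Um)
    (hSm : {x | x ∈ cubeIcc 2 ∧ x 1 ≤ x 0} ⊆ Um)
    (hfm : ContDiffOn ℝ (⊤ : ℕ∞) fm Um)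
    (hfme : Set.EqOn f fm {x | x ∈ cubeIcc 2 ∧ x 1 ≤ x 0})
    (x : Fin 2 → ℝ) (hx : x ∈ cubeIoo 2) (hxd : x 0 = x 1) :
    HasGenDeriv f (fun _ => true) 1 x ((1 / 2) * pderivI 0 (fp - fm) x) := by
  have hx0 := hx 0 (Set.mem_univ _)
  have hx1 := hx 1 (Set.mem_univ _)
  have hxc : x ∈ cubeIcc 2 := by
    refine ⟨fun i => (hx i (Set.mem_univ _)).1.le, fun i => (hx i (Set.mem_univ _)).2.le⟩
  have dp : DifferentiableAt ℝ fp x :=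
    (hfp.contDiffAt (hUp.mem_nhds (hSp ⟨hxc, hxd.le⟩))).differentiableAt (by simp)
  have dm : DifferentiableAt ℝ fm x :=
    (hfm.contDiffAt (hUm.mem_nhds (hSm ⟨hxc, hxd.ge⟩))).differentiableAt (by simp)
  have key : ∀ (g : (Fin 2 → ℝ) → ℝ) (u : Fin 2 → ℝ), DifferentiableAt ℝ g x →
      HasDerivAt (fun h : ℝ => g (x + h • u)) (fderiv ℝ g x u) 0 := by
    intro g u hg
    exact hg.hasFDerivAt.hasLineDerivAt u
  have hG := ((((key fp ![1, 1] dp).sub (key fp ![-1, 1] dp)).sub (key fm ![1, -1] dm)).add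
    (key fm ![-1, -1] dm)).const_mul (1 / 4 : ℝ)
  have hT := hG.tendsto_slope_zero_right
  have hval : (1 / 2) * pderivI 0 (fp - fm) x =
      1 / 4 * (fderiv ℝ fp x ![1, 1] - fderiv ℝ fp x ![-1, 1] - fderiv ℝ fm x ![1, -1] +
        fderiv ℝ fm x ![-1, -1]) := by
    have e1 : (![1, 1] : Fin 2 → ℝ) = ![-1, 1] + (2 : ℝ) • Pi.single 0 1 := by
      ext i; fin_cases i <;> norm_num
    have e2 : (![1, -1] : Fin 2 → ℝ) = ![-1, -1] + (2 : ℝ) • Pi.single 0 1 := by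
      ext i; fin_cases i <;> norm_num
    rw [e1, e2]
    simp only [pderivI, map_add, map_smul, fderiv_sub dp dm, _root_.sub_apply,
      smul_eq_mul]
    ring
  unfold HasGenDeriv
  rw [hval]
  refine hT.congr' ?_
  have hsm : ∀ᶠ h : ℝ in nhdsWithin 0 (Set.Ioi 0), h ∈ Set.Ioo 0 (min (x 0) (1 - x 0)) :=
    Ioo_mem_nhdsGT (lt_min hx0.1 (by linarith [hx0.2]))
  filter_upwards [hsm] with h hh
  have h0 := hh.1
  have h1 := lt_of_lt_of_le hh.2 (min_le_left _ _)
  have h2 := lt_of_lt_of_le hh.2 (min_le_right _ _)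
  have hmem : ∀ a b : ℝ, |a| ≤ 1 → |b| ≤ 1 → x + h • ![a, b] ∈ cubeIcc 2 := by
    intro a b ha hb
    rw [abs_le] at ha hb
    constructor <;> intro i <;> fin_cases i <;> simp <;> nlinarith
  have E1 : f (x + h • ![1, 1]) = fp (x + h • ![1, 1]) :=
    hfpe ⟨hmem _ _ (by norm_num) (by norm_num), by simp; linarith⟩
  have E2 : f (x + h • ![-1, 1]) = fp (x + h • ![-1, 1]) :=
    hfpe ⟨hmem _ _ (by norm_num) (by norm_num), by simp; linarith⟩
  have E3 : f (x + h • ![1, -1]) = fm (x + h • ![1, -1]) :=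
    hfme ⟨hmem _ _ (by norm_num) (by norm_num), by simp; linarith⟩
  have E4 : f (x + h • ![-1, -1]) = fm (x + h • ![-1, -1]) :=
    hfme ⟨hmem _ _ (by norm_num) (by norm_num), by simp; linarith⟩
  have hsum : ∀ F : (Fin 2 → Bool) → ℝ, ∑ w, F w =
      F ![false, false] + F ![true, false] + F ![false, true] + F ![true, true] := by
    intro F
    rw [← (finTwoArrowEquiv Bool).symm.sum_comp, Fintype.sum_prod_type]
    simp [finTwoArrowEquiv]
    ring
  have s1 : shiftVec h ![false, false] = h • ![1, 1] := by
    ext i; fin_cases i <;> simp [shiftVec]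
  have s2 : shiftVec h ![true, false] = h • ![-1, 1] := by
    ext i; fin_cases i <;> simp [shiftVec]
  have s3 : shiftVec h ![false, true] = h • ![1, -1] := by
    ext i; fin_cases i <;> simp [shiftVec]
  have s4 : shiftVec h ![true, true] = h • ![-1, -1] := by
    ext i; fin_cases i <;> simp [shiftVec]
  have g1 : sgn (fun _ : Fin 2 => true) ![false, false] = 1 := by
    have : (Finset.univ.filter fun i : Fin 2 =>
      true = true ∧ (![false, false] : Fin 2 → Bool) i = true).card = 0 := by decide
    unfold sgn; rw [this]; norm_num
  have g2 : sgn (fun _ : Fin 2 => true) ![true, false] = -1 := by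
    have : (Finset.univ.filter fun i : Fin 2 =>
      true = true ∧ (![true, false] : Fin 2 → Bool) i = true).card = 1 := by decide
    unfold sgn; rw [this]; norm_num
  have g3 : sgn (fun _ : Fin 2 => true) ![false, true] = -1 := by
    have : (Finset.univ.filter fun i : Fin 2 =>
      true = true ∧ (![false, true] : Fin 2 → Bool) i = true).card = 1 := by decide
    unfold sgn; rw [this]; norm_num
  have g4 : sgn (fun _ : Fin 2 => true) ![true, true] = 1 := by
    have : (Finset.univ.filter fun i : Fin 2 =>
      true = true ∧ (![true, true] : Fin 2 → Bool) i = true).card = 2 := by decide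
    unfold sgn; rw [this]; norm_num
  unfold dfourier
  rw [hsum, s1, s2, s3, s4, g1, g2, g3, g4, E1, E2, E3, E4]
  simp only [Pi.add_apply, Pi.sub_apply, zero_add, zero_smul, add_zero, smul_eq_mul, pow_one]
  ring

end Paper
end

section
/- Let d, n ∈ ℕ and let g : ((1/n)ℤ)^d ∩ [0,1]^d → ℝ be any function on the lattice points of mesh 1/n in the cube. Then there exists a unique continuous function f : [0,1]^d → ℝ such that f agrees with g on ((1/n)ℤ)^d ∩ [0,1]^d and f is affine on each simplex (1/n)(k + S_σ) of the n-fold subdivided Kuhn triangulation, for every k ∈ {0,1,…,n−1}^d and every permutation σ of {1,…,d}. -/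
open MeasureTheory Filter Set

namespace Paper

variable {d : ℕ}

/-- Extended coordinates: `none ↦ 0`, `some i ↦ y i`. -/
noncomputable def kw (y : Fin d → ℝ) (o : Option (Fin d)) : ℝ := o.elim 0 y

/-- The Kuhn hat function. -/
noncomputable def khat (y : Fin d → ℝ) : ℝ :=
  max 0 (1 + Finset.univ.inf' Finset.univ_nonempty (kw y) -
    Finset.univ.sup' Finset.univ_nonempty (kw y))

theorem kw_continuous (o : Option (Fin d)) : Continuous (fun y : Fin d → ℝ => kw y o) := by
  cases o with
  | none => exact continuous_const
  | some i => exact continuous_apply i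

theorem khat_continuous : Continuous (khat : (Fin d → ℝ) → ℝ) := by
  unfold khat
  refine continuous_const.max ((continuous_const.add ?_).sub ?_)
  · exact Continuous.finset_inf'_apply _ (fun o _ => kw_continuous o)
  · exact Continuous.finset_sup'_apply _ (fun o _ => kw_continuous o)

theorem khat_zero : khat (0 : Fin d → ℝ) = 1 := by
  have h : kw (0 : Fin d → ℝ) = fun _ => (0:ℝ) := by
    funext o; cases o <;> rfl
  unfold khat
  rw [h, Finset.inf'_const, Finset.sup'_const]
  norm_num

theorem khat_int (z : Fin d → ℤ) (hz : z ≠ 0) : khat (fun i => (z i : ℝ)) = 0 := by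
  obtain ⟨i, hi⟩ := Function.ne_iff.1 hz
  unfold khat
  apply max_eq_left
  have h1 := Finset.inf'_le (kw (fun i => (z i : ℝ))) (Finset.mem_univ (some i))
  have h2 := Finset.inf'_le (kw (fun i => (z i : ℝ))) (Finset.mem_univ none)
  have h3 := Finset.le_sup' (kw (fun i => (z i : ℝ))) (Finset.mem_univ (some i))
  have h4 := Finset.le_sup' (kw (fun i => (z i : ℝ))) (Finset.mem_univ none)
  have e1 : kw (fun i => (z i : ℝ)) (some i) = z i := rfl
  have e2 : kw (fun i => (z i : ℝ)) none = 0 := rfl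
  rw [e1] at h1 h3
  rw [e2] at h2 h4
  rcases lt_or_gt_of_ne hi with h | h
  · have : (z i : ℝ) ≤ -1 := by
      have : z i ≤ -1 := by simp at h; omega
      exact_mod_cast this
    linarith
  · have : (1 : ℝ) ≤ z i := by
      have : 1 ≤ z i := by simp at h; omega
      exact_mod_cast this
    linarith

theorem exists_min_family {E ι : Type*} [Fintype ι] [Nonempty ι] (S : Set E) (a : ι → E → ℝ)
    (h : ∀ i j, (∀ x ∈ S, a i x ≤ a j x) ∨ (∀ x ∈ S, a j x ≤ a i x)) :
    ∃ i, ∀ j, ∀ x ∈ S, a i x ≤ a j x := by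
  classical
  suffices H : ∀ s : Finset ι, ∃ i, ∀ j ∈ s, ∀ x ∈ S, a i x ≤ a j x by
    obtain ⟨i, hi⟩ := H Finset.univ
    exact ⟨i, fun j => hi j (Finset.mem_univ j)⟩
  intro s
  induction s using Finset.induction_on with
  | empty => exact ⟨Classical.arbitrary ι, by simp⟩
  | insert b s hb ih =>
    obtain ⟨i, hi⟩ := ih
    rcases h i b with h1 | h1
    · refine ⟨i, fun j hj => ?_⟩
      rcases Finset.mem_insert.1 hj with rfl | hj
      · exact h1
      · exact hi j hj
    · refine ⟨b, fun j hj => ?_⟩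
      rcases Finset.mem_insert.1 hj with rfl | hj
      · exact fun _ _ => le_rfl
      · exact fun x hx => (h1 x hx).trans (hi j hj x hx)

/-- Integer extension. -/
def kz (z : Fin d → ℤ) (o : Option (Fin d)) : ℤ := o.elim 0 z

theorem kw_add (z : Fin d → ℤ) (s : Fin d → ℝ) (o : Option (Fin d)) :
    kw (fun i => (z i : ℝ) + s i) o = (kz z o : ℝ) + kw s o := by
  cases o <;> simp [kw, kz]

theorem kw_mem (σ : Equiv.Perm (Fin d)) (s : Fin d → ℝ) (hs : s ∈ KuhnSimplex σ)
    (o : Option (Fin d)) : 0 ≤ kw s o ∧ kw s o ≤ 1 := by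
  cases o with
  | none => simp [kw]
  | some i => exact ⟨hs.1.1 i, hs.1.2 i⟩

theorem kw_total (σ : Equiv.Perm (Fin d)) (o p : Option (Fin d)) :
    (∀ s ∈ KuhnSimplex σ, kw s o ≤ kw s p) ∨ (∀ s ∈ KuhnSimplex σ, kw s p ≤ kw s o) := by
  cases o with
  | none => exact Or.inl fun s hs => (kw_mem σ s hs p).1
  | some i =>
    cases p with
    | none => exact Or.inr fun s hs => (kw_mem σ s hs (some i)).1
    | some j =>
      rcases le_total (σ.symm i) (σ.symm j) with h | h
      · left; intro s hs; simpa [kw] using hs.2 _ _ h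
      · right; intro s hs; simpa [kw] using hs.2 _ _ h

theorem kw_shift_total (σ : Equiv.Perm (Fin d)) (z : Fin d → ℤ) (c : ℤ) (o p : Option (Fin d)) :
    (∀ s ∈ KuhnSimplex σ, kw (fun i => (z i : ℝ) + s i) o ≤ c + kw (fun i => (z i : ℝ) + s i) p) ∨
    (∀ s ∈ KuhnSimplex σ,
      c + kw (fun i => (z i : ℝ) + s i) p ≤ kw (fun i => (z i : ℝ) + s i) o) := by
  simp only [kw_add]
  rcases lt_trichotomy (kz z o) (c + kz z p) with h | h | h
  · left; intro s hs
    have h1 := kw_mem σ s hs o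
    have h2 := kw_mem σ s hs p
    have : (kz z o : ℝ) + 1 ≤ c + kz z p := by exact_mod_cast h
    linarith
  · have : (kz z o : ℝ) = c + kz z p := by exact_mod_cast h
    rcases kw_total σ o p with h | h
    · left; intro s hs; linarith [h s hs]
    · right; intro s hs; linarith [h s hs]
  · right; intro s hs
    have h1 := kw_mem σ s hs o
    have h2 := kw_mem σ s hs p
    have : (c : ℝ) + kz z p + 1 ≤ kz z o := by exact_mod_cast h
    linarith

theorem khat_simplex (σ : Equiv.Perm (Fin d)) (z : Fin d → ℤ) :
    (∀ s ∈ KuhnSimplex σ, khat (fun i => (z i : ℝ) + s i) = 0) ∨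
    ∃ o p, ∀ s ∈ KuhnSimplex σ, khat (fun i => (z i : ℝ) + s i) =
      1 + kw (fun i => (z i : ℝ) + s i) o - kw (fun i => (z i : ℝ) + s i) p := by
  obtain ⟨o, ho⟩ := exists_min_family (KuhnSimplex σ)
    (fun o s => kw (fun i => (z i : ℝ) + s i) o) (fun i j => by
      simpa using kw_shift_total σ z 0 i j)
  obtain ⟨p, hp⟩ := exists_min_family (KuhnSimplex σ)
    (fun o s => -kw (fun i => (z i : ℝ) + s i) o) (fun i j => by
      simpa using kw_shift_total σ z 0 j i)
  have key : ∀ s ∈ KuhnSimplex σ, khat (fun i => (z i : ℝ) + s i) =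
      max 0 (1 + kw (fun i => (z i : ℝ) + s i) o - kw (fun i => (z i : ℝ) + s i) p) := by
    intro s hs
    unfold khat
    congr 2
    · congr 1
      apply le_antisymm
      · exact Finset.inf'_le _ (Finset.mem_univ o)
      · exact Finset.le_inf' _ _ fun q _ => ho q s hs
    · apply le_antisymm
      · exact Finset.sup'_le _ _ fun q _ => neg_le_neg_iff.1 (hp q s hs)
      · exact Finset.le_sup' _ (Finset.mem_univ p)
  rcases kw_shift_total σ z 1 p o with h | h
  · right
    refine ⟨o, p, fun s hs => ?_⟩
    rw [key s hs]
    apply max_eq_right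
    have := h s hs
    push_cast at this
    linarith
  · left
    intro s hs
    rw [key s hs]
    apply max_eq_left
    have := h s hs
    push_cast at this
    linarith

/-- Affine version of `kw (n x - m)`. -/
noncomputable def kwAff (n : ℝ) (m : Fin d → ℝ) (o : Option (Fin d)) : (Fin d → ℝ) →ᵃ[ℝ] ℝ :=
  o.elim 0 (fun i => n • (LinearMap.proj (R := ℝ) (φ := fun _ : Fin d => ℝ) i).toAffineMap
    - AffineMap.const ℝ (Fin d → ℝ) (m i))

theorem kwAff_apply (n : ℝ) (m : Fin d → ℝ) (o : Option (Fin d)) (x : Fin d → ℝ) :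
    kwAff n m o x = kw (fun i => n * x i - m i) o := by
  cases o <;> simp [kwAff, kw]

theorem khat_affine (n : ℕ) (hn : 0 < n) (m : Fin d → ℤ) (k : Fin d → Fin n)
    (σ : Equiv.Perm (Fin d)) :
    ∃ A : (Fin d → ℝ) →ᵃ[ℝ] ℝ, Set.EqOn (fun x => khat (fun i => (n : ℝ) * x i - (m i : ℝ))) A
      ((fun y i => (((k i : ℕ) : ℝ) + y i) / n) '' KuhnSimplex σ) := by
  have hn' : (n : ℝ) ≠ 0 := by positivity
  have e : ∀ s : Fin d → ℝ, (fun i => (n : ℝ) * ((((k i : ℕ) : ℝ) + s i) / n) - (m i : ℝ))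
      = fun i => (((((k i : ℕ) : ℤ) - m i : ℤ)) : ℝ) + s i := by
    intro s; funext i; push_cast; field_simp; ring
  rcases khat_simplex σ (fun i => ((k i : ℕ) : ℤ) - m i) with h | ⟨o, p, h⟩
  · refine ⟨0, ?_⟩
    rintro _ ⟨s, hs, rfl⟩
    simp only [e]
    rw [h s hs]; rfl
  · refine ⟨AffineMap.const ℝ _ 1 + kwAff n (fun i => (m i : ℝ)) o
      - kwAff n (fun i => (m i : ℝ)) p, ?_⟩
    rintro _ ⟨s, hs, rfl⟩
    have : ∀ x, (AffineMap.const ℝ (Fin d → ℝ) (1:ℝ) + kwAff (n:ℝ) (fun i => (m i : ℝ)) o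
      - kwAff n (fun i => (m i : ℝ)) p) x = 1 + kwAff (n:ℝ) (fun i => (m i : ℝ)) o x
      - kwAff n (fun i => (m i : ℝ)) p x := fun x => rfl
    rw [this]
    simp only [kwAff_apply, e]
    exact h s hs

theorem affOn_sum {ι : Type*} (t : Finset ι) (S : Set (Fin d → ℝ)) (c : ι → ℝ)
    (h : ι → (Fin d → ℝ) → ℝ)
    (H : ∀ i, ∃ A : (Fin d → ℝ) →ᵃ[ℝ] ℝ, Set.EqOn (h i) A S) :
    ∃ A : (Fin d → ℝ) →ᵃ[ℝ] ℝ, Set.EqOn (fun x => ∑ i ∈ t, c i * h i x) A S := by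
  classical
  induction t using Finset.induction_on with
  | empty => exact ⟨0, fun x _ => by simp⟩
  | insert b t hb ih =>
    obtain ⟨A, hA⟩ := ih
    obtain ⟨B, hB⟩ := H b
    refine ⟨c b • B + A, fun x hx => ?_⟩
    have h1 := hA hx
    have h2 := hB hx
    simp only at h1
    simp [Finset.sum_insert hb, h1, h2]

/-- Vertices of the Kuhn simplex. -/
noncomputable def kvert (σ : Equiv.Perm (Fin d)) (j : ℕ) : Fin d → ℕ :=
  fun l => if j ≤ (σ.symm l : ℕ) then 1 else 0

theorem kvert_le (σ : Equiv.Perm (Fin d)) (j : ℕ) (l : Fin d) : kvert σ j l ≤ 1 := by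
  unfold kvert; split_ifs <;> simp

theorem kvert_mem (σ : Equiv.Perm (Fin d)) (j : ℕ) :
    (fun l => (kvert σ j l : ℝ)) ∈ KuhnSimplex σ := by
  refine ⟨⟨fun l => ?_, fun l => ?_⟩, fun a b hab => ?_⟩
  · simp
  · simpa using kvert_le σ j l
  · have : kvert σ j (σ a) ≤ kvert σ j (σ b) := by
      have : (a : ℕ) ≤ b := hab
      unfold kvert
      simp only [Equiv.symm_apply_apply]
      split_ifs <;> omega
    exact Nat.cast_le.2 this

theorem aff_eq_of_vert (σ : Equiv.Perm (Fin d)) (C : (Fin d → ℝ) →ᵃ[ℝ] ℝ)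
    (h : ∀ j, C (fun l => (kvert σ j l : ℝ)) = 0) (x : Fin d → ℝ) : C x = 0 := by
  have h0 : C 0 = 0 := by
    have := h d
    have e : (fun l => (kvert σ d l : ℝ)) = 0 := by
      funext l
      have := (σ.symm l).2
      simp [kvert]
    rwa [e] at this
  have hl : C.linear = 0 := by
    apply LinearMap.pi_ext'
    intro i
    apply LinearMap.ext_ring
    have e : (Pi.single i 1 : Fin d → ℝ) = (fun l => (kvert σ (σ.symm i) l : ℝ)) -ᵥ
        (fun l => (kvert σ ((σ.symm i : ℕ) + 1) l : ℝ)) := by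
      funext l
      simp only [vsub_eq_sub, Pi.sub_apply, kvert]
      by_cases hli : l = i
      · subst hli; simp
      · have : (σ.symm l : ℕ) ≠ σ.symm i := by
          intro hh; exact hli (σ.symm.injective (Fin.ext hh))
        rw [Pi.single_eq_of_ne hli]
        split_ifs <;> first | omega | simp
    simp only [LinearMap.comp_apply, LinearMap.coe_single]
    rw [e, AffineMap.linearMap_vsub, h, h]
    simp
  have := AffineMap.linearMap_vsub C x 0
  rw [hl, h0] at this
  simpa using this.symm

theorem cube_cover (n : ℕ) (hn : 0 < n) (x : Fin d → ℝ) (hx : x ∈ cubeIcc d) :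
    ∃ (k : Fin d → Fin n) (σ : Equiv.Perm (Fin d)) (y : Fin d → ℝ), y ∈ KuhnSimplex σ ∧
      (fun i => (((k i : ℕ) : ℝ) + y i) / n) = x := by
  have hn' : (0 : ℝ) < n := by exact_mod_cast hn
  have H : ∀ i, ∃ k : Fin n, 0 ≤ (n : ℝ) * x i - (k : ℕ) ∧ (n : ℝ) * x i - (k : ℕ) ≤ 1 := by
    intro i
    have h0 : 0 ≤ x i := hx.1 i
    have h1 : x i ≤ 1 := hx.2 i
    by_cases hc : ⌊(n : ℝ) * x i⌋₊ < n
    · refine ⟨⟨_, hc⟩, ?_, ?_⟩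
      · have := Nat.floor_le (mul_nonneg hn'.le h0)
        simp only; linarith
      · have := Nat.lt_floor_add_one ((n : ℝ) * x i)
        simp only; linarith
    · push Not at hc
      have h2 : (n : ℝ) ≤ n * x i := (Nat.le_floor_iff (mul_nonneg hn'.le h0)).1 hc
      have h3 : (n : ℝ) * x i ≤ n := by nlinarith
      refine ⟨⟨n - 1, by omega⟩, ?_, ?_⟩
      · simp only [Nat.cast_sub (show 1 ≤ n from hn)]; push_cast; linarith
      · simp only [Nat.cast_sub (show 1 ≤ n from hn)]; push_cast; linarith
  choose k hk0 hk1 using H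
  refine ⟨k, Tuple.sort (fun i => (n : ℝ) * x i - (k i : ℕ)), fun i => (n : ℝ) * x i - (k i : ℕ),
    ⟨⟨hk0, hk1⟩, fun i j hij => Tuple.monotone_sort (fun i => (n : ℝ) * x i - (k i : ℕ)) hij⟩, ?_⟩
  funext i
  field_simp
  ring

/-- The map from the reference simplex as an affine map. -/
noncomputable def kmap (n : ℕ) (k : Fin d → Fin n) : (Fin d → ℝ) →ᵃ[ℝ] (Fin d → ℝ) :=
  (n : ℝ)⁻¹ • (AffineMap.const ℝ (Fin d → ℝ) (fun i => ((k i : ℕ) : ℝ)) + AffineMap.id ℝ _)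

theorem kmap_apply (n : ℕ) (k : Fin d → Fin n) (y : Fin d → ℝ) :
    kmap n k y = fun i => (((k i : ℕ) : ℝ) + y i) / n := by
  funext i
  simp [kmap]
  ring

/-- For every function `g` on the lattice points of mesh `1/n` in the cube
there is a unique continuous function `f : [0,1]^d → ℝ` agreeing with `g` on the lattice
points and affine on each simplex `(1/n)(k + S_σ)` of the `n`-fold subdivided Kuhn
triangulation. -/
theorem statement10 (d n : ℕ) (hn : 0 < n) (g : (Fin d → Fin (n + 1)) → ℝ) :
    ∃ f : (Fin d → ℝ) → ℝ,
      (ContinuousOn f (cubeIcc d) ∧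
        (∀ m : Fin d → Fin (n + 1), f (fun i => ((m i : ℕ) : ℝ) / n) = g m) ∧
        (∀ (k : Fin d → Fin n) (σ : Equiv.Perm (Fin d)),
          ∃ A : (Fin d → ℝ) →ᵃ[ℝ] ℝ,
            Set.EqOn f A ((fun y i => (((k i : ℕ) : ℝ) + y i) / n) '' KuhnSimplex σ))) ∧
      ∀ f' : (Fin d → ℝ) → ℝ,
        (ContinuousOn f' (cubeIcc d) ∧
          (∀ m : Fin d → Fin (n + 1), f' (fun i => ((m i : ℕ) : ℝ) / n) = g m) ∧
          (∀ (k : Fin d → Fin n) (σ : Equiv.Perm (Fin d)),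
            ∃ A : (Fin d → ℝ) →ᵃ[ℝ] ℝ,
              Set.EqOn f' A ((fun y i => (((k i : ℕ) : ℝ) + y i) / n) '' KuhnSimplex σ))) →
        Set.EqOn f' f (cubeIcc d) := by
  have hn' : (n : ℝ) ≠ 0 := by positivity
  have hex : ∃ f : (Fin d → ℝ) → ℝ,
      (ContinuousOn f (cubeIcc d) ∧
        (∀ m : Fin d → Fin (n + 1), f (fun i => ((m i : ℕ) : ℝ) / n) = g m) ∧
        (∀ (k : Fin d → Fin n) (σ : Equiv.Perm (Fin d)),
          ∃ A : (Fin d → ℝ) →ᵃ[ℝ] ℝ,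
            Set.EqOn f A ((fun y i => (((k i : ℕ) : ℝ) + y i) / n) '' KuhnSimplex σ))) := by
    refine ⟨fun x => ∑ m : Fin d → Fin (n + 1),
      g m * khat (fun i => (n : ℝ) * x i - (((m i : ℕ) : ℤ) : ℝ)), ?_, ?_, ?_⟩
    · apply Continuous.continuousOn
      refine continuous_finsetSum _ fun m _ => continuous_const.mul (khat_continuous.comp ?_)
      fun_prop
    · intro m
      have e : ∀ m' : Fin d → Fin (n + 1),
          (fun i => (n : ℝ) * (((m i : ℕ) : ℝ) / n) - (((m' i : ℕ) : ℤ) : ℝ)) =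
          fun i => ((((m i : ℕ) : ℤ) - ((m' i : ℕ) : ℤ) : ℤ) : ℝ) := by
        intro m'; funext i; push_cast; field_simp
      simp only [e]
      rw [Finset.sum_eq_single m]
      · have : (fun i => ((((m i : ℕ) : ℤ) - ((m i : ℕ) : ℤ) : ℤ) : ℝ)) = (0 : Fin d → ℝ) := by
          funext i; simp
        rw [this, khat_zero, mul_one]
      · intro m' _ hne
        rw [khat_int (fun i => ((m i : ℕ) : ℤ) - ((m' i : ℕ) : ℤ)), mul_zero]
        intro h
        apply hne
        funext i
        have := congrFun h i
        simp only [Pi.zero_apply] at this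
        apply Fin.ext
        omega
      · simp
    · intro k σ
      exact affOn_sum _ _ _ _ fun m => khat_affine n hn (fun i => ((m i : ℕ) : ℤ)) k σ
  obtain ⟨f, hf⟩ := hex
  refine ⟨f, hf, ?_⟩
  rintro f' ⟨-, hf'2, hf'3⟩ x hx
  obtain ⟨k, σ, y, hy, rfl⟩ := cube_cover n hn x hx
  obtain ⟨A, hA⟩ := hf.2.2 k σ
  obtain ⟨B, hB⟩ := hf'3 k σ
  have hC := aff_eq_of_vert σ ((B - A).comp (kmap n k)) (fun j => by
    have hmem : (fun i => (((k i : ℕ) : ℝ) + (kvert σ j i : ℝ)) / n) ∈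
        (fun (y : Fin d → ℝ) i => (((k i : ℕ) : ℝ) + y i) / n) '' KuhnSimplex σ :=
      ⟨_, kvert_mem σ j, rfl⟩
    have h1 := hA hmem
    have h2 := hB hmem
    have e : (fun i => (((k i : ℕ) : ℝ) + (kvert σ j i : ℝ)) / n) =
        fun i => ((((⟨(k i : ℕ) + kvert σ j i, by
          have := kvert_le σ j i
          have := (k i).2
          omega⟩ : Fin (n + 1)) : ℕ)) : ℝ) / n := by
      funext i; push_cast; rfl
    have h3 := hf.2.1 (fun i => ⟨(k i : ℕ) + kvert σ j i, by
          have := kvert_le σ j i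
          have := (k i).2
          omega⟩)
    have h4 := hf'2 (fun i => ⟨(k i : ℕ) + kvert σ j i, by
          have := kvert_le σ j i
          have := (k i).2
          omega⟩)
    rw [← e] at h3 h4
    rw [AffineMap.comp_apply, kmap_apply, AffineMap.coe_sub, Pi.sub_apply, ← h1, ← h2, h3, h4, sub_self]) y
  rw [AffineMap.comp_apply, kmap_apply, AffineMap.coe_sub, Pi.sub_apply] at hC
  rw [hA ⟨y, hy, rfl⟩, hB ⟨y, hy, rfl⟩]
  linarith

end Paper
end

section
/- Let d ∈ ℕ and let f_0, …, f_d : [0,1]^d → ℝ be functions each of which extends to a C^∞ function on an open neighbourhood of [0,1]^d. Then for all v_0, …, v_d ∈ {0,1}^d: lim_{n→∞} (2n)^{∑_{i=0}^d |v_i|} ∫_{[0,1]^d} ∏_{i=0}^d Δ̃_n^{v_i} f_i(x) dx = ∫_{[0,1]^d} ∏_{i=0}^d D^{v_i} f_i(x) dx, where D^v f := (∂/∂x_1)^{v_1}⋯(∂/∂x_d)^{v_d} f. -/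
open MeasureTheory Filter Set

namespace Paper

variable {d : ℕ}

lemma exists_ext (f : (Fin d → ℝ) → ℝ) (U : Set (Fin d → ℝ)) (hU : IsOpen U)
    (hc : cubeIcc d ⊆ U) (hf : ContDiffOn ℝ (⊤ : ℕ∞) f U) :
    ∃ g : (Fin d → ℝ) → ℝ, ContDiff ℝ (⊤ : ℕ∞) g ∧
      ∃ V : Set (Fin d → ℝ), IsOpen V ∧ cubeIcc d ⊆ V ∧ Set.EqOn f g V := by
  have hK : IsCompact (cubeIcc d) := isCompact_Icc
  obtain ⟨L, hL, hKL, hLU⟩ := exists_compact_between hK hU hc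
  obtain ⟨χ, h1, h0, -⟩ := exists_contMDiffMap_one_nhds_of_subset_interior
    (n := (⊤ : ℕ∞)) (modelWithCornersSelf ℝ (Fin d → ℝ)) hK.isClosed hKL
  have hχ : ContDiff ℝ (⊤ : ℕ∞) χ := χ.contMDiff.contDiff
  obtain ⟨V, hV, hKV, hV1⟩ := eventually_nhdsSet_iff_exists.1 h1
  refine ⟨fun x => χ x * f x, ?_, V, hV, hKV, fun x hx => by simp [hV1 x hx]⟩
  rw [contDiff_iff_contDiffAt]
  intro x
  by_cases hx : x ∈ U
  · exact hχ.contDiffAt.mul (hf.contDiffAt (hU.mem_nhds hx))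
  · have : (fun x => χ x * f x) =ᶠ[nhds x] fun _ => 0 := by
      filter_upwards [hL.isClosed.isOpen_compl.mem_nhds (fun h => hx (hLU h))] with y hy
      rw [h0 y hy, zero_mul]
    exact contDiffAt_const.congr_of_eventuallyEq this

noncomputable def Dl (v : Fin d → Bool) (l : List (Fin d)) (f : (Fin d → ℝ) → ℝ) :
    (Fin d → ℝ) → ℝ :=
  l.foldr (fun i g => cond (v i) (pderivI i g) g) f

lemma Dl_eqOn (v : Fin d → Bool) (l : List (Fin d)) (f g : (Fin d → ℝ) → ℝ)
    (V : Set (Fin d → ℝ)) (hV : IsOpen V) (h : Set.EqOn f g V) :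
    Set.EqOn (Dl v l f) (Dl v l g) V := by
  induction l with
  | nil => exact h
  | cons i l ih =>
    intro x hx
    simp only [Dl, List.foldr_cons]
    cases v i
    · exact ih hx
    · change fderiv ℝ (Dl v l f) x _ = fderiv ℝ (Dl v l g) x _
      rw [Filter.EventuallyEq.fderiv_eq (ih.eventuallyEq_of_mem (hV.mem_nhds hx))]

lemma pderivI_contDiff (i : Fin d) (f : (Fin d → ℝ) → ℝ) (hf : ContDiff ℝ (⊤ : ℕ∞) f) :
    ContDiff ℝ (⊤ : ℕ∞) (pderivI i f) := by
  have : ContDiff ℝ (⊤ : ℕ∞) (fderiv ℝ f) := hf.fderiv_right (by exact_mod_cast le_top)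
  exact this.clm_apply contDiff_const

lemma Dl_contDiff (v : Fin d → Bool) (l : List (Fin d)) (f : (Fin d → ℝ) → ℝ)
    (hf : ContDiff ℝ (⊤ : ℕ∞) f) : ContDiff ℝ (⊤ : ℕ∞) (Dl v l f) := by
  induction l with
  | nil => exact hf
  | cons i l ih =>
    simp only [Dl, List.foldr_cons]
    cases v i
    · exact ih
    · exact pderivI_contDiff i _ ih

noncomputable def cf (v : Fin d → Bool) (h : ℝ) (i : Fin d) (b : Bool) : ℝ :=
  if v i then (if b then -(1 / h) else 1 / h) else 1

def sh (h : ℝ) (b : Bool) : ℝ := if b then -h else h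

noncomputable def op (v : Fin d → Bool) (h : ℝ) (i : Fin d) (f : (Fin d → ℝ) → ℝ) :
    (Fin d → ℝ) → ℝ :=
  fun x => (1 / 2) * (cf v h i false * f (x + Pi.single i (sh h false))
    + cf v h i true * f (x + Pi.single i (sh h true)))

lemma op_contDiff (v : Fin d → Bool) (h : ℝ) (i : Fin d) (f : (Fin d → ℝ) → ℝ)
    (hf : ContDiff ℝ (⊤ : ℕ∞) f) : ContDiff ℝ (⊤ : ℕ∞) (op v h i f) := by
  unfold op
  fun_prop

lemma pderivI_op (v : Fin d → Bool) (h : ℝ) (i j : Fin d) (f : (Fin d → ℝ) → ℝ)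
    (hf : ContDiff ℝ (⊤ : ℕ∞) f) : pderivI j (op v h i f) = op v h i (pderivI j f) := by
  have hd : Differentiable ℝ f := hf.differentiable (by simp)
  have hk : ∀ x a : Fin d → ℝ, HasFDerivAt (fun y => f (y + a)) (fderiv ℝ f (x + a)) x :=
    fun x a => (hasFDerivAt_comp_add_right a).2 (hd _).hasFDerivAt
  funext x
  have := (((hk x (Pi.single i (sh h false))).const_mul (cf v h i false)).add
    ((hk x (Pi.single i (sh h true))).const_mul (cf v h i true))).const_mul (1 / 2)
  have e := this.fderiv
  unfold pderivI
  change (fderiv ℝ (fun y => (1 / 2) * (cf v h i false * f (y + Pi.single i (sh h false))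
    + cf v h i true * f (y + Pi.single i (sh h true)))) x) _ = _
  erw [e]
  simp [op]
  ring

lemma Dl_op (v : Fin d → Bool) (h : ℝ) (i : Fin d) (l : List (Fin d)) (f : (Fin d → ℝ) → ℝ)
    (hf : ContDiff ℝ (⊤ : ℕ∞) f) : Dl v l (op v h i f) = op v h i (Dl v l f) := by
  induction l with
  | nil => rfl
  | cons j l ih =>
    change (cond (v j) (pderivI j (Dl v l (op v h i f))) (Dl v l (op v h i f)))
      = op v h i (cond (v j) (pderivI j (Dl v l f)) (Dl v l f))
    rw [ih]
    cases v j
    · rfl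
    · exact pderivI_op v h i j _ (Dl_contDiff v l f hf)

lemma op_mvt (v : Fin d → Bool) (h : ℝ) (hh : 0 < h) (i : Fin d) (f : (Fin d → ℝ) → ℝ)
    (hf : ContDiff ℝ (⊤ : ℕ∞) f) (x : Fin d → ℝ) :
    ∃ t : ℝ, |t| ≤ h ∧
      op v h i f x = (cond (v i) (pderivI i f) f) (x + Pi.single i t) := by
  have hd : Differentiable ℝ f := hf.differentiable (by simp)
  have hline : ∀ t : ℝ, HasDerivAt (fun t : ℝ => x + Pi.single i t)
      (Pi.single i (1 : ℝ)) t := by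
    intro t
    rw [hasDerivAt_pi]
    intro j
    by_cases hj : j = i
    · subst hj
      simpa using (hasDerivAt_id t).const_add (x j)
    · simpa [Pi.single_apply, hj] using hasDerivAt_const t (x j)
  have hF : ∀ t : ℝ, HasDerivAt (fun t : ℝ => f (x + Pi.single i t))
      (pderivI i f (x + Pi.single i t)) t := fun t =>
    (hd (x + Pi.single i t)).hasFDerivAt.comp_hasDerivAt t (hline t)
  have hcont : Continuous (fun t : ℝ => f (x + Pi.single i t)) :=
    continuous_iff_continuousAt.2 fun t => (hF t).continuousAt
  cases hv : v i
  · have hpre : IsPreconnected (Icc (-h) h) := isPreconnected_Icc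
    set F := fun t : ℝ => f (x + Pi.single i t) with hFdef
    have hmem : op v h i f x ∈ uIcc (F (-h)) (F h) := by
      have : op v h i f x = (F (-h) + F h) / 2 := by
        simp [op, cf, hv, sh, F]; ring
      rw [this, mem_uIcc]
      rcases le_total (F (-h)) (F h) with h1 | h1
      · left; constructor <;> linarith
      · right; constructor <;> linarith
    obtain ⟨t, ht, hte⟩ := intermediate_value_uIcc (hcont.continuousOn) hmem
    rw [uIcc_of_le (by linarith)] at ht
    exact ⟨t, abs_le.2 ht, hte.symm⟩
  · obtain ⟨t, ht, hte⟩ := exists_hasDerivAt_eq_slope _ _ (show -h < h by linarith)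
      hcont.continuousOn (fun t _ => hF t)
    refine ⟨t, abs_le.2 ⟨ht.1.le, ht.2.le⟩, ?_⟩
    simp only [cond_true]
    rw [hte]
    simp only [op, cf, hv, sh]
    have : h ≠ 0 := hh.ne'
    simp
    field_simp
    ring

noncomputable def Sl (v : Fin d → Bool) (h : ℝ) : List (Fin d) → ((Fin d → ℝ) → ℝ) →
    ((Fin d → ℝ) → ℝ)
  | [], f => f
  | i :: l, f => Sl v h l (op v h i f)

lemma Sl_mvt (v : Fin d → Bool) (h : ℝ) (hh : 0 < h) (l : List (Fin d)) (hl : l.Nodup)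
    (f : (Fin d → ℝ) → ℝ) (hf : ContDiff ℝ (⊤ : ℕ∞) f) (x : Fin d → ℝ) :
    ∃ ξ : Fin d → ℝ, (∀ j, |ξ j - x j| ≤ h) ∧ (∀ j, j ∉ l → ξ j = x j) ∧
      Sl v h l f x = Dl v l f ξ := by
  induction l generalizing f with
  | nil => exact ⟨x, by simp [hh.le], by simp, rfl⟩
  | cons i l ih =>
    obtain ⟨hi, hl'⟩ := List.nodup_cons.1 hl
    obtain ⟨ξ, h1, h2, h3⟩ := ih hl' (op v h i f) (op_contDiff v h i f hf)
    obtain ⟨t, ht, hte⟩ := op_mvt v h hh i (Dl v l f) (Dl_contDiff v l f hf) ξ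
    refine ⟨ξ + Pi.single i t, ?_, ?_, ?_⟩
    · intro j
      by_cases hj : j = i
      · subst hj
        simpa [h2 j hi] using ht
      · simpa [Pi.single_apply, hj] using h1 j
    · intro j hj
      rw [List.mem_cons, not_or] at hj
      simpa [Pi.single_apply, hj.1] using h2 j hj.2
    · change Sl v h l (op v h i f) x = _
      rw [h3, Dl_op v h i l f hf, hte]
      rfl

lemma flip_sum (i : Fin d) (F : (Fin d → Bool) → ℝ) :
    ∑ w, F w = ∑ w, (1 / 2) * (F (Function.update w i false) + F (Function.update w i true)) := by
  have hinv : Function.Involutive (fun w : Fin d → Bool => Function.update w i (!w i)) := by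
    intro w
    simp
  have h1 : ∑ w, F (Function.update w i (!w i)) = ∑ w, F w :=
    Equiv.sum_comp hinv.toPerm F
  have h2 : ∀ w : Fin d → Bool, F (Function.update w i false) + F (Function.update w i true)
      = F w + F (Function.update w i (!w i)) := by
    intro w
    have := Function.update_eq_self i w
    cases hw : w i
    · rw [hw] at this
      simp [this]
    · rw [hw] at this
      simp [this, add_comm]
  simp_rw [h2]
  rw [← Finset.mul_sum, Finset.sum_add_distrib, h1]
  ring

lemma Sl_expand (v : Fin d → Bool) (h : ℝ) (l : List (Fin d)) (hl : l.Nodup)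
    (f : (Fin d → ℝ) → ℝ) (x : Fin d → ℝ) :
    Sl v h l f x = (1 / 2 ^ d) * ∑ w : Fin d → Bool,
      (l.map fun i => cf v h i (w i)).prod *
        f (x + (l.map fun i => Pi.single i (sh h (w i))).sum) := by
  induction l generalizing f with
  | nil => simp [Sl]
  | cons i l ih =>
    obtain ⟨hi, hl'⟩ := List.nodup_cons.1 hl
    change Sl v h l (op v h i f) x = _
    rw [ih hl']
    conv_rhs => rw [flip_sum i]
    congr 1
    refine Finset.sum_congr rfl fun w _ => ?_
    have e1 : ∀ b, (l.map fun j => cf v h j (Function.update w i b j))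
        = l.map fun j => cf v h j (w j) := by
      intro b
      refine List.map_congr_left fun j hj => ?_
      have hne : j ≠ i := fun e => hi (e ▸ hj)
      rw [Function.update_of_ne hne]
    have e2 : ∀ b, (l.map fun j => (Pi.single j (sh h (Function.update w i b j)) : Fin d → ℝ))
        = l.map fun j => Pi.single j (sh h (w j)) := by
      intro b
      refine List.map_congr_left fun j hj => ?_
      have hne : j ≠ i := fun e => hi (e ▸ hj)
      rw [Function.update_of_ne hne]
    simp only [List.map_cons, List.prod_cons, List.sum_cons, e1, e2, Function.update_self, op]
    rw [add_assoc, add_assoc, add_comm (List.sum _), add_comm (List.sum _)]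
    ring

lemma Sl_dfourier (v : Fin d → Bool) (h : ℝ) (f : (Fin d → ℝ) → ℝ) (x : Fin d → ℝ) :
    (1 / h) ^ wt v * dfourier f v h x = Sl v h (List.finRange d) f x := by
  rw [Sl_expand v h _ (List.nodup_finRange d), dfourier, mul_left_comm, Finset.mul_sum]
  congr 1
  refine Finset.sum_congr rfl fun w _ => ?_
  rw [← Fin.prod_univ_def, ← Fin.sum_univ_def, Finset.univ_sum_single, ← mul_assoc]
  congr 1
  have : ∀ i, cf v h i (w i) = (if v i = true then 1 / h else 1) *
      (if v i = true ∧ w i = true then -1 else 1) := by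
    intro i
    unfold cf
    cases v i <;> cases w i <;> simp
  simp_rw [this]
  rw [Finset.prod_mul_distrib, Finset.prod_ite, Finset.prod_ite]
  simp [wt, sgn]

lemma cell_bound (n : ℕ) (hn : 0 < n) (x : ℝ) (hx : x ∈ Set.Ico (0 : ℝ) 1) (y : ℝ)
    (hy : |y - ((⌊(n : ℝ) * x⌋ : ℝ) / n + 1 / (2 * n))| ≤ 1 / (2 * n)) :
    0 ≤ y ∧ y ≤ 1 ∧ |y - x| ≤ 1 / n := by
  have hn' : (0 : ℝ) < n := by exact_mod_cast hn
  have h0 : (0 : ℤ) ≤ ⌊(n : ℝ) * x⌋ := Int.floor_nonneg.2 (mul_nonneg hn'.le hx.1)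
  have h1 : ⌊(n : ℝ) * x⌋ + 1 ≤ (n : ℤ) := by
    have : ⌊(n : ℝ) * x⌋ < (n : ℤ) := by
      rw [Int.floor_lt]
      push_cast
      nlinarith [hx.2]
    omega
  have h2 := Int.floor_le ((n : ℝ) * x)
  have h3 := Int.lt_floor_add_one ((n : ℝ) * x)
  have h0' : (0 : ℝ) ≤ ⌊(n : ℝ) * x⌋ := by exact_mod_cast h0
  have h1' : (⌊(n : ℝ) * x⌋ : ℝ) + 1 ≤ n := by exact_mod_cast h1
  set k : ℝ := (⌊(n : ℝ) * x⌋ : ℝ)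
  have e : (1 : ℝ) / (2 * n) = 1 / n / 2 := by field_simp
  rw [e] at hy
  obtain ⟨ha, hb⟩ := abs_le.1 hy
  have ha' : k / n ≤ y := by linarith
  have hb' : y ≤ k / n + 1 / n := by linarith
  have c1 : 0 ≤ k / n := by positivity
  have c2 : k / n + 1 / n ≤ 1 := by
    rw [← add_div, div_le_one hn']; exact h1'
  have c3 : k / n ≤ x := by rw [div_le_iff₀ hn']; linarith
  have c4 : x ≤ k / n + 1 / n := by rw [← add_div, le_div_iff₀ hn']; linarith
  exact ⟨by linarith, by linarith, abs_le.2 ⟨by linarith, by linarith⟩⟩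

lemma lattice_congr (n : ℕ) (hn : 0 < n) (f g : (Fin d → ℝ) → ℝ)
    (hfg : Set.EqOn f g (cubeIcc d)) (v : Fin d → Bool) (x : Fin d → ℝ) (hx : x ∈ cubeIco d) :
    latticeDelta n f v x = latticeDelta n g v x := by
  have hn' : (0 : ℝ) < n := by exact_mod_cast hn
  have hx' : ∀ i, x i ∈ Set.Ico (0 : ℝ) 1 := fun i => hx i (mem_univ i)
  have hh : (0 : ℝ) < 1 / (2 * n) := by positivity
  unfold latticeDelta dfourier
  congr 1
  refine Finset.sum_congr rfl fun w _ => ?_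
  rw [hfg]
  have hb := fun j => cell_bound n hn (x j) (hx' j)
    ((latticeCenter n x + shiftVec (1 / (2 * n)) w) j) (by
      simp only [Pi.add_apply, latticeCenter, shiftVec, add_sub_cancel_left]
      split_ifs
      · rw [abs_neg, abs_of_pos hh]
      · rw [abs_of_pos hh])
  exact ⟨fun j => (hb j).1, fun j => (hb j).2.1⟩

lemma lattice_mvt (n : ℕ) (hn : 0 < n) (f g : (Fin d → ℝ) → ℝ) (hg : ContDiff ℝ (⊤ : ℕ∞) g)
    (hfg : Set.EqOn f g (cubeIcc d)) (v : Fin d → Bool) (x : Fin d → ℝ) (hx : x ∈ cubeIco d) :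
    ∃ ξ : Fin d → ℝ, ξ ∈ cubeIcc d ∧ (∀ j, |ξ j - x j| ≤ 1 / n) ∧
      ((2 * n : ℕ) : ℝ) ^ wt v * latticeDelta n f v x = Dl v (List.finRange d) g ξ := by
  have hn' : (0 : ℝ) < n := by exact_mod_cast hn
  have hx' : ∀ i, x i ∈ Set.Ico (0 : ℝ) 1 := fun i => hx i (mem_univ i)
  have hh : (0 : ℝ) < 1 / (2 * n) := by positivity
  obtain ⟨ξ, h1, -, h3⟩ := Sl_mvt v (1 / (2 * n)) hh (List.finRange d) (List.nodup_finRange d)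
    g hg (latticeCenter n x)
  have hb := fun j => cell_bound n hn (x j) (hx' j) (ξ j) (h1 j)
  refine ⟨ξ, ⟨fun j => (hb j).1, fun j => (hb j).2.1⟩, fun j => (hb j).2.2, ?_⟩
  rw [← h3, ← Sl_dfourier]
  have e : latticeDelta n f v x = dfourier g v (1 / (2 * n)) (latticeCenter n x) :=
    lattice_congr n hn f g hfg v x hx
  rw [e]
  simp

lemma latticeDelta_measurable (n : ℕ) (g : (Fin d → ℝ) → ℝ) (hg : Continuous g)
    (v : Fin d → Bool) : Measurable (latticeDelta n g v) := by
  have hc : Measurable (latticeCenter (d := d) n) := by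
    unfold latticeCenter
    refine measurable_pi_lambda _ fun i => ?_
    have : Measurable fun x : Fin d → ℝ => (⌊(n : ℝ) * x i⌋ : ℝ) :=
      (measurable_from_top (f := fun z : ℤ => (z : ℝ))).comp
        (Int.measurable_floor.comp ((measurable_pi_apply i).const_mul _))
    exact (this.div_const _).add_const _
  unfold latticeDelta dfourier
  refine Measurable.const_mul (Finset.measurable_sum _ fun w _ => ?_) _
  exact (hg.measurable.comp (hc.add_const _)).const_mul _


/-- Let `f_0,…,f_d : [0,1]^d → ℝ` extend to `C^∞` functions on an open
neighbourhood of the cube.  Then for all `v_0,…,v_d ∈ {0,1}^d`,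
`lim_{n→∞} (2n)^{∑|v_i|} ∫_{[0,1]^d} ∏ Δ̃_n^{v_i} f_i = ∫_{[0,1]^d} ∏ D^{v_i} f_i`. -/
theorem statement11 {d : ℕ} (f : Fin (d + 1) → (Fin d → ℝ) → ℝ)
    (hf : ∀ i, ∃ U : Set (Fin d → ℝ), IsOpen U ∧ cubeIcc d ⊆ U ∧ ContDiffOn ℝ (⊤ : ℕ∞) (f i) U)
    (v : Fin (d + 1) → Fin d → Bool) :
    Tendsto (fun n : ℕ =>
        ((2 * n : ℕ) : ℝ) ^ (∑ i, wt (v i)) *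
          ∫ x in cubeIco d, ∏ i, latticeDelta n (f i) (v i) x)
      atTop (nhds (∫ x in cubeIcc d, ∏ i, Dmixed (v i) (f i) x)) := by
  choose U hU hcU hfU using hf
  choose g hg V hV hcV hfg using fun i => exists_ext (f i) (U i) (hU i) (hcU i) (hfU i)
  have hfg' : ∀ i, Set.EqOn (f i) (g i) (cubeIcc d) := fun i => (hfg i).mono (hcV i)
  have hK : IsCompact (cubeIcc d) := isCompact_Icc
  have hsub : cubeIco d ⊆ cubeIcc d := fun x hx =>
    ⟨fun i => (hx i (mem_univ i)).1, fun i => (hx i (mem_univ i)).2.le⟩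
  have hcont : ∀ i, Continuous (Dl (v i) (List.finRange d) (g i)) := fun i =>
    (Dl_contDiff (v i) (List.finRange d) (g i) (hg i)).continuous
  have hmeasI : MeasurableSet (cubeIco d) :=
    MeasurableSet.univ_pi fun _ => measurableSet_Ico
  have hae : (cubeIco d : Set (Fin d → ℝ)) =ᵐ[volume] cubeIcc d :=
    Measure.univ_pi_Ico_ae_eq_Icc (f := (0 : Fin d → ℝ)) (g := 1)
  have hlim : ∫ x in cubeIcc d, ∏ i, Dmixed (v i) (f i) x
      = ∫ x in cubeIco d, ∏ i, Dl (v i) (List.finRange d) (g i) x := by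
    rw [setIntegral_congr_set hae.symm]
    refine setIntegral_congr_fun hmeasI fun x hx => ?_
    refine Finset.prod_congr rfl fun i _ => ?_
    exact Dl_eqOn (v i) _ (f i) (g i) (V i) (hV i) (hfg i) (hcV i (hsub hx))
  rw [hlim]
  have hseq : ∀ n : ℕ, ((2 * n : ℕ) : ℝ) ^ (∑ i, wt (v i)) *
          ∫ x in cubeIco d, ∏ i, latticeDelta n (f i) (v i) x
      = ∫ x in cubeIco d, ∏ i, (((2 * n : ℕ) : ℝ) ^ wt (v i) * latticeDelta n (f i) (v i) x) := by
    intro n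
    rw [← integral_const_mul]
    refine integral_congr_ae (Eventually.of_forall fun x => ?_)
    simp only [Finset.prod_mul_distrib, Finset.prod_pow_eq_pow_sum]
  simp_rw [hseq]
  choose C hC using fun i => hK.exists_bound_of_continuousOn (hcont i).continuousOn
  have hfin : volume (cubeIco d) < ⊤ := (measure_mono hsub).trans_lt hK.measure_lt_top
  refine tendsto_integral_filter_of_dominated_convergence (fun _ => ∏ i, C i) ?_ ?_ ?_ ?_
  · filter_upwards [eventually_gt_atTop 0] with n hn
    have hm : Measurable fun x => ∏ i, (((2 * n : ℕ) : ℝ) ^ wt (v i) *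
        latticeDelta n (g i) (v i) x) :=
      Finset.measurable_prod _ fun i _ =>
        (latticeDelta_measurable n (g i) (hg i).continuous (v i)).const_mul _
    refine hm.aestronglyMeasurable.congr ?_
    filter_upwards [ae_restrict_mem hmeasI] with x hx
    refine Finset.prod_congr rfl fun i _ => ?_
    congr 1
    have hx' : ∀ i, x i ∈ Set.Ico (0 : ℝ) 1 := fun i => hx i (mem_univ i)
    exact (lattice_congr n hn (f i) (g i) (hfg' i) (v i) x hx).symm
  · filter_upwards [eventually_gt_atTop 0] with n hn
    filter_upwards [ae_restrict_mem hmeasI] with x hx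
    rw [norm_prod]
    refine Finset.prod_le_prod (fun i _ => norm_nonneg _) fun i _ => ?_
    obtain ⟨ξ, h1, -, h3⟩ := lattice_mvt n hn (f i) (g i) (hg i) (hfg' i) (v i) x hx
    rw [h3]
    exact hC i ξ h1
  · exact integrableOn_const hfin.ne
  · filter_upwards [ae_restrict_mem hmeasI] with x hx
    refine tendsto_finsetProd _ fun i _ => ?_
    have key : ∀ n : ℕ, ∃ ξ : Fin d → ℝ, 0 < n → (∀ j, |ξ j - x j| ≤ 1 / n) ∧
        ((2 * n : ℕ) : ℝ) ^ wt (v i) * latticeDelta n (f i) (v i) x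
          = Dl (v i) (List.finRange d) (g i) ξ := by
      intro n
      by_cases hn : 0 < n
      · obtain ⟨ξ, -, h2, h3⟩ := lattice_mvt n hn (f i) (g i) (hg i) (hfg' i) (v i) x hx
        exact ⟨ξ, fun _ => ⟨h2, h3⟩⟩
      · exact ⟨0, fun h => absurd h hn⟩
    choose ξ hξ using key
    have hξx : Tendsto ξ atTop (nhds x) := by
      rw [tendsto_pi_nhds]
      intro j
      rw [tendsto_iff_norm_sub_tendsto_zero]
      refine tendsto_of_tendsto_of_tendsto_of_le_of_le' tendsto_const_nhds
        tendsto_one_div_atTop_nhds_zero_nat (Eventually.of_forall fun n => norm_nonneg _) ?_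
      filter_upwards [eventually_gt_atTop 0] with n hn
      exact (hξ n hn).1 j
    refine (((hcont i).tendsto x).comp hξx).congr' ?_
    filter_upwards [eventually_gt_atTop 0] with n hn
    exact ((hξ n hn).2).symm

end Paper
end

section
/- Let f_0, f_1, f_2, f_3 : [0,1]^3 → ℝ be functions each of which extends to a C^∞ function on an open neighbourhood of [0,1]^3, and let B be the collection of the four 4-element subsets of {0,1}^3: {(1,0,0),(0,1,0),(0,0,1),(1,1,1)}, {(1,0,0),(0,1,0),(1,0,1),(0,1,1)}, {(1,0,0),(0,0,1),(1,1,0),(0,1,1)}, {(0,1,0),(0,0,1),(1,1,0),(1,0,1)}. Then lim_{n→∞} 64 · n^6 · ∑_{(v_0,v_1,v_2,v_3)} ∫_{[0,1)^3} ∏_{i=0}^3 Δ̃_n^{v_i} f_i(x) dx = ∫_{[0,1]^3} ∑_{(v_0,v_1,v_2,v_3)} ∏_{i=0}^3 D^{v_i} f_i(x) dx, where both sums run over all ordered quadruples (v_0,v_1,v_2,v_3) of elements of {0,1}^3 whose underlying set {v_0,v_1,v_2,v_3} belongs to B, and D^v f := (∂/∂x_1)^{v_1}(∂/∂x_2)^{v_2}(∂/∂x_3)^{v_3}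 f. -/
open MeasureTheory Filter Set

namespace Paper

variable {d : ℕ}

/-- The collection `B` of the four distinguished 4-element subsets of `{0,1}³`. -/
def Bcoll : Finset (Finset (Fin 3 → Bool)) :=
  { {![true, false, false], ![false, true, false], ![false, false, true], ![true, true, true]},
    {![true, false, false], ![false, true, false], ![true, false, true], ![false, true, true]},
    {![true, false, false], ![false, false, true], ![true, true, false], ![false, true, true]},
    {![false, true, false], ![false, false, true], ![true, true, false], ![true, false, true]} }

theorem wt_sum (v : Fin 4 → Fin 3 → Bool) (hv : Finset.image v Finset.univ ∈ Bcoll) :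
    ∑ i, wt (v i) = 6 := by
  have h1 : ∀ S ∈ Bcoll, S.card = 4 ∧ ∑ u ∈ S, wt u = 6 := by
    set_option maxRecDepth 100000 in decide
  obtain ⟨hc, hs⟩ := h1 _ hv
  have hinj : Function.Injective v := by
    have h2 := Finset.card_image_iff.mp (hc.trans (by simp : 4 = (Finset.univ : Finset (Fin 4)).card))
    rwa [Finset.coe_univ, Set.injOn_univ] at h2
  rw [Finset.sum_image (fun a _ b _ h => hinj h)] at hs
  exact hs

def Good (g : (Fin 3 → ℝ) → ℝ) : Prop :=
  ∃ U : Set (Fin 3 → ℝ), IsOpen U ∧ cubeIcc 3 ⊆ U ∧ ContDiffOn ℝ (⊤ : ℕ∞) g U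

theorem Good.pd {g : (Fin 3 → ℝ) → ℝ} (hg : Good g) (i : Fin 3) : Good (pderivI i g) := by
  obtain ⟨U, hU, hc, hd⟩ := hg
  refine ⟨U, hU, hc, ?_⟩
  have h := hd.fderiv_of_isOpen (m := ((⊤ : ℕ∞) : WithTop ℕ∞)) hU (by simp)
  exact h.clm_apply contDiffOn_const

theorem Good.cnd {g : (Fin 3 → ℝ) → ℝ} (hg : Good g) (b : Bool) (i : Fin 3) :
    Good (cond b (pderivI i g) g) := by
  cases b
  · exact hg
  · exact hg.pd i

theorem Good.cont {g : (Fin 3 → ℝ) → ℝ} (hg : Good g) : ContinuousOn g (cubeIcc 3) := by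
  obtain ⟨U, hU, hc, hd⟩ := hg
  exact hd.continuousOn.mono hc

theorem Good.diff {g : (Fin 3 → ℝ) → ℝ} (hg : Good g) {x} (hx : x ∈ cubeIcc 3) :
    DifferentiableAt ℝ g x := by
  obtain ⟨U, hU, hc, hd⟩ := hg
  exact (hd.contDiffAt (hU.mem_nhds (hc hx))).differentiableAt (by simp)

theorem Dmixed_eq (v : Fin 3 → Bool) (g : (Fin 3 → ℝ) → ℝ) :
    Dmixed v g = cond (v 0) (pderivI 0 (cond (v 1) (pderivI 1 (cond (v 2) (pderivI 2 g) g))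
      (cond (v 2) (pderivI 2 g) g))) (cond (v 1) (pderivI 1 (cond (v 2) (pderivI 2 g) g))
      (cond (v 2) (pderivI 2 g) g)) := by
  rfl

theorem Good.dm {g : (Fin 3 → ℝ) → ℝ} (hg : Good g) (v : Fin 3 → Bool) : Good (Dmixed v g) := by
  rw [Dmixed_eq]
  exact ((hg.cnd _ _).cnd _ _).cnd _ _

theorem step {g : (Fin 3 → ℝ) → ℝ} (hg : Good g) (b : Bool) (i : Fin 3) {ι : Type} [Fintype ι]
    (c : ι → ℝ) (p : ι → Fin 3 → ℝ) (h : ℝ) (hh : 0 < h)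
    (hp : ∀ k, ∀ t ∈ Set.Icc (-h) h, p k + t • Pi.single i (1 : ℝ) ∈ cubeIcc 3) :
    ∃ t ∈ Set.Icc (-h) h,
      ((∑ k, c k * g (p k + h • Pi.single i (1 : ℝ))) + cond b (-1) 1 *
        ∑ k, c k * g (p k + (-h) • Pi.single i (1 : ℝ))) / 2 =
      h ^ (cond b 1 0) * ∑ k, c k * (cond b (pderivI i g) g) (p k + t • Pi.single i (1 : ℝ)) := by
  set φ : ℝ → ℝ := fun t => ∑ k, c k * g (p k + t • Pi.single i (1 : ℝ)) with hφ
  have hder : ∀ t ∈ Set.Icc (-h) h, HasDerivAt φ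
      (∑ k, c k * pderivI i g (p k + t • Pi.single i (1 : ℝ))) t := by
    intro t ht
    refine HasDerivAt.fun_sum fun k _ => HasDerivAt.const_mul _ ?_
    have h1 : HasDerivAt (fun t : ℝ => p k + t • (Pi.single i (1 : ℝ) : Fin 3 → ℝ))
        (Pi.single i (1 : ℝ)) t := by
      simpa using ((hasDerivAt_id t).smul_const (Pi.single i (1 : ℝ) : Fin 3 → ℝ)).const_add (p k)
    exact (hg.diff (hp k t ht)).hasFDerivAt.comp_hasDerivAt t h1
  have hcont : ContinuousOn φ (Set.Icc (-h) h) := fun t ht =>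
    (hder t ht).continuousAt.continuousWithinAt
  cases b
  · have hle : -h ≤ h := by linarith
    have hsub := intermediate_value_uIcc (a := -h) (b := h) (f := φ)
      (by rwa [Set.uIcc_of_le hle])
    have hm : (φ h + φ (-h)) / 2 ∈ Set.uIcc (φ (-h)) (φ h) := by
      rw [Set.mem_uIcc]
      rcases le_total (φ h) (φ (-h)) with h1 | h1
      · right; constructor <;> linarith
      · left; constructor <;> linarith
    obtain ⟨t, ht, he⟩ := hsub hm
    rw [Set.uIcc_of_le hle] at ht
    refine ⟨t, ht, ?_⟩
    simp only [cond_false, one_mul, pow_zero]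
    exact he.symm
  · obtain ⟨t, ht, he⟩ := exists_hasDerivAt_eq_slope φ _ (by linarith : -h < h) hcont
      (fun t ht => hder t (Set.Ioo_subset_Icc_self ht))
    refine ⟨t, Set.Ioo_subset_Icc_self ht, ?_⟩
    simp only [cond_true, pow_one]
    rw [he]
    change (φ h + -1 * φ (-h)) / 2 = _
    field_simp
    ring

theorem sum_bool3 (F : (Fin 3 → Bool) → ℝ) :
    ∑ w, F w = ∑ a : Bool, ∑ b : Bool, ∑ c : Bool, F ![a, b, c] := by
  rw [← (Fin.consEquiv (fun _ : Fin 3 => Bool)).sum_comp, Fintype.sum_prod_type]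
  refine Finset.sum_congr rfl fun a _ => ?_
  rw [← (Fin.consEquiv (fun _ : Fin 2 => Bool)).sum_comp, Fintype.sum_prod_type]
  refine Finset.sum_congr rfl fun b _ => ?_
  rw [← (Fin.consEquiv (fun _ : Fin 1 => Bool)).sum_comp, Fintype.sum_prod_type]
  refine Finset.sum_congr rfl fun c _ => ?_
  simp
  rfl

def sg (v w : Bool) : ℝ := cond (v && w) (-1) 1

def ep (h : ℝ) (w : Bool) : ℝ := cond w (-h) h

theorem sgn_eq (v : Fin 3 → Bool) (a b c : Bool) :
    sgn v ![a, b, c] = sg (v 0) a * sg (v 1) b * sg (v 2) c := by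
  have : sgn v ![a, b, c] = ∏ i, sg (v i) (![a, b, c] i) := by
    unfold sgn sg
    rw [← Finset.prod_const, Finset.prod_filter]
    refine Finset.prod_congr rfl fun i _ => ?_
    cases v i <;> cases (![a, b, c] i) <;> simp
  rw [this, Fin.prod_univ_three]
  rfl

theorem wt_eq (v : Fin 3 → Bool) : wt v = cond (v 0) 1 0 + cond (v 1) 1 0 + cond (v 2) 1 0 := by
  revert v; decide

theorem mem_cube (x : Fin 3 → ℝ) : x ∈ cubeIcc 3 ↔ ∀ i, 0 ≤ x i ∧ x i ≤ 1 := by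
  simp only [cubeIcc, Set.mem_Icc, Pi.le_def, forall_and]
  rfl

theorem dfourier_eq {g : (Fin 3 → ℝ) → ℝ} (hg : Good g) (v : Fin 3 → Bool) (h : ℝ) (hh : 0 < h)
    (x : Fin 3 → ℝ) (hx : ∀ i, h ≤ x i ∧ x i ≤ 1 - h) :
    ∃ y : Fin 3 → ℝ, (∀ i, |y i - x i| ≤ h) ∧ dfourier g v h x = h ^ wt v * Dmixed v g y := by
  have hep : ∀ a, ep h a ∈ Set.Icc (-h) h := by
    intro a; cases a <;> simp only [ep, cond_true, cond_false, Set.mem_Icc] <;> constructor <;> linarith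
  have hx0 := hx 0
  have hx1 := hx 1
  have hx2 := hx 2
  obtain ⟨t2, ht2, e2⟩ := step hg (v 2) 2 (ι := Bool × Bool)
    (fun k => sg (v 0) k.1 * sg (v 1) k.2) (fun k => ![x 0 + ep h k.1, x 1 + ep h k.2, x 2]) h hh (by
      intro k t ht
      have h0 := hep k.1
      have h1 := hep k.2
      simp only [Set.mem_Icc] at h0 h1 ht
      rw [mem_cube]
      intro i
      fin_cases i <;> simp [Pi.single_apply] <;> constructor <;> linarith)
  obtain ⟨t1, ht1, e1⟩ := step (hg.cnd (v 2) 2) (v 1) 1 (ι := Bool)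
    (fun k => sg (v 0) k) (fun k => ![x 0 + ep h k, x 1, x 2 + t2]) h hh (by
      intro k t ht
      have h0 := hep k
      simp only [Set.mem_Icc] at h0 ht ht2
      rw [mem_cube]
      intro i
      fin_cases i <;> simp [Pi.single_apply] <;> constructor <;> linarith)
  obtain ⟨t0, ht0, e0⟩ := step ((hg.cnd (v 2) 2).cnd (v 1) 1) (v 0) 0 (ι := Unit)
    (fun k => 1) (fun k => ![x 0, x 1 + t1, x 2 + t2]) h hh (by
      intro k t ht
      simp only [Set.mem_Icc] at ht ht1 ht2
      rw [mem_cube]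
      intro i
      fin_cases i <;> simp [Pi.single_apply] <;> constructor <;> linarith)
  refine ⟨![x 0 + t0, x 1 + t1, x 2 + t2], ?_, ?_⟩
  · intro i
    simp only [Set.mem_Icc] at ht0 ht1 ht2
    fin_cases i <;> simp [abs_le] <;> constructor <;> linarith
  have q2 : ∀ a b c t : ℝ, (![a, b, c] : Fin 3 → ℝ) + t • Pi.single 2 (1 : ℝ) = ![a, b, c + t] := by
    intro a b c t; ext i; fin_cases i <;> simp [Pi.single_apply]
  have q1 : ∀ a b c t : ℝ, (![a, b, c] : Fin 3 → ℝ) + t • Pi.single 1 (1 : ℝ) = ![a, b + t, c] := by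
    intro a b c t; ext i; fin_cases i <;> simp [Pi.single_apply]
  have q0 : ∀ a b c t : ℝ, (![a, b, c] : Fin 3 → ℝ) + t • Pi.single 0 (1 : ℝ) = ![a + t, b, c] := by
    intro a b c t; ext i; fin_cases i <;> simp [Pi.single_apply]
  have qs : ∀ a b c, x + shiftVec h ![a, b, c] = ![x 0 + ep h a, x 1 + ep h b, x 2 + ep h c] := by
    intro a b c; ext i
    fin_cases i
    · cases a <;> simp [shiftVec, ep]
    · cases b <;> simp [shiftVec, ep]
    · cases c <;> simp [shiftVec, ep]
  simp only [q2, Fintype.sum_prod_type, Fintype.sum_bool] at e2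
  simp only [q1, Fintype.sum_bool] at e1
  simp only [q0, Finset.univ_unique, Finset.sum_singleton, one_mul] at e0
  rw [Dmixed_eq, wt_eq, pow_add, pow_add, mul_assoc, mul_assoc, mul_left_comm,
    mul_left_comm (h ^ cond (v 0) 1 0)]
  have sgT : ∀ b, sg b true = cond b (-1) 1 := by intro b; cases b <;> rfl
  have sgF : ∀ b, sg b false = 1 := by intro b; cases b <;> rfl
  unfold dfourier
  rw [sum_bool3]
  simp only [sgn_eq, qs, Fintype.sum_bool, sgT, sgF]
  simp only [sgT, sgF] at e1 e2
  simp only [ep, cond_true, cond_false, one_mul, mul_one] at *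
  generalize (cond (v 0) (-1) 1 : ℝ) = s0 at *
  generalize (cond (v 1) (-1) 1 : ℝ) = s1 at *
  generalize (cond (v 2) (-1) 1 : ℝ) = s2 at *
  rw [mul_left_comm, ← e0]
  linear_combination (1/4) * e2 + (1/2) * h ^ cond (v 2) 1 0 * e1

theorem lattice_eq {g : (Fin 3 → ℝ) → ℝ} (hg : Good g) (v : Fin 3 → Bool) (n : ℕ) (hn : 0 < n)
    (x : Fin 3 → ℝ) (hx : x ∈ cubeIco 3) :
    ∃ y ∈ cubeIcc 3, (∀ i, |y i - x i| ≤ 1 / n) ∧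
      (2 * (n : ℝ)) ^ wt v * latticeDelta n g v x = Dmixed v g y := by
  have hn' : (0 : ℝ) < n := by exact_mod_cast hn
  have hk : ∀ i, 0 ≤ (⌊(n : ℝ) * x i⌋ : ℝ) / n ∧ (⌊(n : ℝ) * x i⌋ : ℝ) / n + 1 / n ≤ 1 ∧
      (⌊(n : ℝ) * x i⌋ : ℝ) / n ≤ x i ∧ x i ≤ (⌊(n : ℝ) * x i⌋ : ℝ) / n + 1 / n := by
    intro i
    have hxi : x i ∈ Set.Ico (0 : ℝ) 1 := hx i (Set.mem_univ i)
    have h0 : 0 ≤ ⌊(n : ℝ) * x i⌋ := Int.floor_nonneg.mpr (mul_nonneg hn'.le hxi.1)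
    have h1 : ⌊(n : ℝ) * x i⌋ < (n : ℤ) := by
      rw [Int.floor_lt]; push_cast; nlinarith [hxi.2]
    have h0' : (0 : ℝ) ≤ ⌊(n : ℝ) * x i⌋ := by exact_mod_cast h0
    have h1' : (⌊(n : ℝ) * x i⌋ : ℝ) + 1 ≤ n := by exact_mod_cast h1
    have h2 := Int.floor_le ((n : ℝ) * x i)
    have h3 := (Int.lt_floor_add_one ((n : ℝ) * x i)).le
    refine ⟨by positivity, ?_, ?_, ?_⟩
    · rw [← add_div, div_le_one hn']; exact h1'
    · rw [div_le_iff₀ hn']; linarith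
    · rw [← add_div, le_div_iff₀ hn']; linarith
  have hhalf : (1 : ℝ) / n = 1 / (2 * n) + 1 / (2 * n) := by field_simp; norm_num
  obtain ⟨y, hy, he⟩ := dfourier_eq hg v (1 / (2 * n)) (by positivity) (latticeCenter n x) (by
    intro i
    have := hk i
    simp only [latticeCenter]
    constructor <;> linarith)
  refine ⟨y, ?_, ?_, ?_⟩
  · rw [mem_cube]
    intro i
    have h1 := abs_le.mp (hy i)
    have := hk i
    simp only [latticeCenter] at h1
    constructor <;> linarith
  · intro i
    have h1 := abs_le.mp (hy i)
    have := hk i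
    simp only [latticeCenter] at h1
    rw [abs_le]
    constructor <;> linarith
  · unfold latticeDelta
    rw [he, ← mul_assoc, ← mul_pow]
    have : 2 * (n : ℝ) * (1 / (2 * n)) = 1 := by field_simp
    rw [this]; simp

theorem lattice_meas (n : ℕ) (g : (Fin 3 → ℝ) → ℝ) (v : Fin 3 → Bool) :
    Measurable (latticeDelta n g v) := by
  have h1 : Measurable (fun x : Fin 3 → ℝ => fun i => ⌊(n : ℝ) * x i⌋) := by
    refine measurable_pi_lambda _ fun i => ?_
    exact Int.measurable_floor.comp ((measurable_pi_apply i).const_mul _)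
  have h2 : Measurable (fun k : Fin 3 → ℤ =>
      dfourier g v (1 / (2 * n)) (fun i => (k i : ℝ) / n + 1 / (2 * n))) :=
    measurable_of_countable _
  exact h2.comp h1

theorem Ico_sub : cubeIco 3 ⊆ cubeIcc 3 := by
  intro x hx
  rw [mem_cube]
  intro i
  have : x i ∈ Set.Ico (0 : ℝ) 1 := hx i (Set.mem_univ i)
  exact ⟨this.1, this.2.le⟩

theorem lattice_tendsto {g : (Fin 3 → ℝ) → ℝ} (hg : Good g) (v : Fin 3 → Bool)
    (x : Fin 3 → ℝ) (hx : x ∈ cubeIco 3) :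
    Tendsto (fun n : ℕ => (2 * (n : ℝ)) ^ wt v * latticeDelta n g v x) atTop
      (nhds (Dmixed v g x)) := by
  have hc := (hg.dm v).cont x (Ico_sub hx)
  rw [Metric.continuousWithinAt_iff] at hc
  rw [Metric.tendsto_atTop]
  intro ε hε
  obtain ⟨δ, hδ, H⟩ := hc ε hε
  obtain ⟨N, hN⟩ := exists_nat_one_div_lt hδ
  refine ⟨N + 1, fun n hn => ?_⟩
  obtain ⟨y, hy, hd, he⟩ := lattice_eq hg v n (by omega) x hx
  rw [he]
  refine H hy ?_
  rw [dist_pi_lt_iff hδ]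
  intro i
  rw [Real.dist_eq]
  refine (hd i).trans_lt (lt_of_le_of_lt ?_ hN)
  apply one_div_le_one_div_of_le (by positivity)
  exact_mod_cast hn

theorem cube_compact : IsCompact (cubeIcc 3) := isCompact_Icc

theorem term_tendsto (f : Fin 4 → (Fin 3 → ℝ) → ℝ) (hf : ∀ i, Good (f i))
    (v : Fin 4 → Fin 3 → Bool) :
    Tendsto (fun n : ℕ => ∫ x in cubeIco 3,
        ∏ i, ((2 * (n : ℝ)) ^ wt (v i) * latticeDelta n (f i) (v i) x)) atTop
      (nhds (∫ x in cubeIco 3, ∏ i, Dmixed (v i) (f i) x)) := by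
  have hC : ∀ i, ∃ C, ∀ y ∈ cubeIcc 3, ‖Dmixed (v i) (f i) y‖ ≤ C := fun i =>
    cube_compact.exists_bound_of_continuousOn ((hf i).dm (v i)).cont
  choose C hC using hC
  have hmeas : MeasurableSet (cubeIco 3) := MeasurableSet.univ_pi fun _ => measurableSet_Ico
  have hfin : volume (cubeIco 3) ≠ ⊤ :=
    ((measure_mono Ico_sub).trans_lt cube_compact.measure_lt_top).ne
  rw [← tendsto_add_atTop_iff_nat 1]
  refine tendsto_integral_of_dominated_convergence (fun _ => ∏ i, C i) ?_ ?_ ?_ ?_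
  · intro n
    exact (Finset.measurable_prod _ fun i _ =>
      (lattice_meas _ _ _).const_mul _).aestronglyMeasurable
  · exact integrableOn_const hfin
  · intro n
    refine (ae_restrict_iff' hmeas).mpr (Eventually.of_forall fun x hx => ?_)
    rw [norm_prod]
    refine Finset.prod_le_prod (fun _ _ => norm_nonneg _) fun i _ => ?_
    obtain ⟨y, hy, hd, he⟩ := lattice_eq (hf i) (v i) (n + 1) (by omega) x hx
    rw [he]
    exact hC i y hy
  · refine (ae_restrict_iff' hmeas).mpr (Eventually.of_forall fun x hx => ?_)
    refine tendsto_finset_prod _ fun i _ => ?_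
    exact (tendsto_add_atTop_iff_nat 1).mpr (lattice_tendsto (hf i) (v i) x hx)

theorem cube_ae : cubeIco 3 =ᵐ[volume] cubeIcc 3 :=
  Measure.univ_pi_Ico_ae_eq_Icc

/-- Let `f_0,…,f_3 : [0,1]³ → ℝ` extend to `C^∞` functions on an open
neighbourhood of the cube.  Then
`lim_{n→∞} 64·n⁶·∑_{(v_0,…,v_3)} ∫_{[0,1)³} ∏ Δ̃_n^{v_i} f_i = ∫_{[0,1]³} ∑_{(v_0,…,v_3)} ∏ D^{v_i} f_i`,
where both sums run over the ordered quadruples whose underlying set lies in `B`. -/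
theorem statement15 (f : Fin 4 → (Fin 3 → ℝ) → ℝ)
    (hf : ∀ i, ∃ U : Set (Fin 3 → ℝ), IsOpen U ∧ cubeIcc 3 ⊆ U ∧ ContDiffOn ℝ (⊤ : ℕ∞) (f i) U) :
    Tendsto (fun n : ℕ =>
        64 * (n : ℝ) ^ 6 *
          ∑ v ∈ Finset.univ.filter
              (fun v : Fin 4 → Fin 3 → Bool => Finset.image v Finset.univ ∈ Bcoll),
            ∫ x in cubeIco 3, ∏ i, latticeDelta n (f i) (v i) x)
      atTop
      (nhds (∫ x in cubeIcc 3,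
        ∑ v ∈ Finset.univ.filter
            (fun v : Fin 4 → Fin 3 → Bool => Finset.image v Finset.univ ∈ Bcoll),
          ∏ i, Dmixed (v i) (f i) x)) := by
  have hmain := tendsto_finset_sum (Finset.univ.filter
      (fun v : Fin 4 → Fin 3 → Bool => Finset.image v Finset.univ ∈ Bcoll))
      (fun v _ => term_tendsto f hf v)
  rw [integral_finset_sum]
  · simp only [← setIntegral_congr_set cube_ae]
    refine hmain.congr fun n => ?_
    rw [Finset.mul_sum]
    refine Finset.sum_congr rfl fun v hv => ?_
    rw [← integral_const_mul]
    congr 1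
    ext x
    rw [Finset.prod_mul_distrib, Finset.prod_pow_eq_pow_sum,
      wt_sum v (Finset.mem_filter.mp hv).2]
    ring
  · intro v _
    refine ContinuousOn.integrableOn_compact cube_compact ?_
    exact continuousOn_finset_prod _ fun i _ => (Good.dm (hf i) (v i)).cont

end Paper
end
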